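/- arXiv:1304.1703 — 6 statements merged into one kernel-verified Lean document; each statement's English description precedes it below -/
import Mathlib

section
/- Let c>0 and let h:(−∞,0)→(0,c) be the inverse of τ*(d)=−4π·I₁(d)/I₀(d). Define F(τ*,z)=√(c²−h(τ*)²)·exp(−τ*/8+τ*(z+1)/4)·Θ(τ*(z+1)/2 | τ*)/Θ(τ*z/2 | τ*). Then there exist constants C>0 and T₀<0 such that for all τ*<T₀ and all z∈[−1/2,1/2], |F(τ*,z)| ≤ C·e^{τ*/8}. -/
/-- `I₀(d) = ∫_d^c dy/√((c²−y²)(y²−d²))`. -/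
noncomputable def I0 (c d : ℝ) : ℝ :=
  ∫ y in d..c, 1 / Real.sqrt ((c^2 - y^2) * (y^2 - d^2))

/-- `I₁(d) = ∫₀^d dy/√((c²−y²)(d²−y²))`. -/
noncomputable def I1 (c d : ℝ) : ℝ :=
  ∫ y in (0:ℝ)..d, 1 / Real.sqrt ((c^2 - y^2) * (d^2 - y^2))

/-- `τ*(d) = −4π·I₁(d)/I₀(d)`. -/
noncomputable def tauStar (c d : ℝ) : ℝ := -4 * Real.pi * I1 c d / I0 c d

/-- The theta function `Θ(z|τ) = ∑_{m∈ℤ} exp(τm²/2 + zm)` for real arguments. -/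
noncomputable def ThetaR (z τ : ℝ) : ℝ :=
  ∑' m : ℤ, Real.exp (τ * (m : ℝ)^2 / 2 + z * m)

/-- `F(τ*,z) = √(c²−h(τ*)²)·exp(−τ*/8+τ*(z+1)/4)·Θ(τ*(z+1)/2|τ*)/Θ(τ*z/2|τ*)`. -/
noncomputable def Ffun (c : ℝ) (h : ℝ → ℝ) (τ z : ℝ) : ℝ :=
  Real.sqrt (c^2 - (h τ)^2) * Real.exp (-τ/8 + τ*(z+1)/4) *
    ThetaR (τ*(z+1)/2) τ / ThetaR (τ*z/2) τ

open Real Set MeasureTheory in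
lemma I0_lower (c d : ℝ) (hd : 0 < d) (hdc : d < c) : π / 2 ≤ c * I0 c d := by
  have hc : 0 < c := hd.trans hdc
  have hD : 0 < c^2 - d^2 := by nlinarith
  set G : ℝ → ℝ := fun y => (1/2) * arcsin ((2*y^2 - c^2 - d^2)/(c^2-d^2)) with hG
  set g : ℝ → ℝ := fun y => y * (1 / Real.sqrt ((c^2 - y^2) * (y^2 - d^2))) with hg
  have hcont : ContinuousOn G (Icc d c) := by
    apply Continuous.continuousOn
    exact continuous_const.mul (continuous_arcsin.comp (by fun_prop))
  have hderiv : ∀ y ∈ Ioo d c, HasDerivAt G (g y) y := by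
    intro y hy
    obtain ⟨h1, h2⟩ := hy
    have hP : 0 < c^2 - y^2 := by nlinarith
    have hQ : 0 < y^2 - d^2 := by nlinarith
    have hu : HasDerivAt (fun y : ℝ => (2*y^2 - c^2 - d^2)/(c^2-d^2)) ((2*(2*y))/(c^2-d^2)) y := by
      have := ((((hasDerivAt_pow 2 y).const_mul 2).sub_const (c^2)).sub_const (d^2)).div_const (c^2-d^2)
      simpa using this
    have e1 : (2*y^2 - c^2 - d^2)/(c^2-d^2) ≠ -1 := by
      intro h; rw [div_eq_iff hD.ne'] at h; nlinarith
    have e2 : (2*y^2 - c^2 - d^2)/(c^2-d^2) ≠ 1 := by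
      intro h; rw [div_eq_iff hD.ne'] at h; nlinarith
    have h3 := ((hasDerivAt_arcsin e1 e2).comp y hu).const_mul (1/2)
    have e3 : 1 - ((2*y^2 - c^2 - d^2)/(c^2-d^2))^2 = ((c^2 - y^2) * (y^2 - d^2)) * (2/(c^2-d^2))^2 := by
      field_simp; ring
    rw [e3, Real.sqrt_mul (by positivity), Real.sqrt_sq (by positivity)] at h3
    refine HasDerivAt.congr_deriv (f := G) h3 ?_
    have : 0 < √((c^2 - y^2) * (y^2 - d^2)) := Real.sqrt_pos.2 (by positivity)
    simp only [hg]
    field_simp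
  have hpos : ∀ y ∈ Ioo d c, 0 ≤ g y := by
    intro y hy
    have : 0 < y := hd.trans hy.1
    simp only [hg]; positivity
  have hgi := intervalIntegral.integrableOn_deriv_of_nonneg hcont hderiv hpos
  have hgi' : IntervalIntegrable g volume d c := (intervalIntegrable_iff_integrableOn_Ioc_of_le hdc.le).2 hgi
  have hF := intervalIntegral.integral_eq_sub_of_hasDerivAt_of_le hdc.le hcont hderiv hgi'
  have v1 : G c = π/4 := by
    have : (2*c^2 - c^2 - d^2)/(c^2-d^2) = 1 := by field_simp; ring
    simp only [hG, this, arcsin_one]; ring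
  have v2 : G d = -(π/4) := by
    have : (2*d^2 - c^2 - d^2)/(c^2-d^2) = -1 := by field_simp; ring
    simp only [hG, this, arcsin_neg, arcsin_one]; ring
  have hfi : IntervalIntegrable (fun y => 1 / Real.sqrt ((c^2 - y^2) * (y^2 - d^2))) volume d c := by
    rw [intervalIntegrable_iff_integrableOn_Ioc_of_le hdc.le]
    refine Integrable.mono' (hgi.const_mul (1/d)) (by
      apply Measurable.aestronglyMeasurable; fun_prop) ?_
    refine (ae_restrict_iff' measurableSet_Ioc).2 (Filter.Eventually.of_forall fun y hy => ?_)
    rw [Real.norm_of_nonneg (by positivity)]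
    simp only [hg]
    rw [← mul_assoc]
    refine le_mul_of_one_le_left (by positivity) ?_
    rw [one_div_mul_eq_div, one_le_div hd]; exact hy.1.le
  have hm : ∫ y in d..c, g y ≤ ∫ y in d..c, c * (1 / Real.sqrt ((c^2 - y^2) * (y^2 - d^2))) := by
    refine intervalIntegral.integral_mono_on hdc.le hgi' (hfi.const_mul c) ?_
    intro y hy
    simp only [hg]
    exact mul_le_mul_of_nonneg_right hy.2 (by positivity)
  rw [hF, intervalIntegral.integral_const_mul, v1, v2] at hm
  unfold I0
  linarith

open Real Set MeasureTheory in
lemma I1_upper (c d : ℝ) (hd : 0 < d) (hdc : d < c) :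
    c * I1 c d ≤ log (2*c) - log (√(c^2-d^2)) + π/2 := by
  have hc : 0 < c := hd.trans hdc
  have hD : 0 < c^2 - d^2 := by nlinarith
  set H : ℝ → ℝ := fun y => -log (√(c^2-y^2) + √(d^2-y^2)) + arcsin (y/d) with hH
  set g : ℝ → ℝ := fun y => y / (√(c^2-y^2) * √(d^2-y^2)) + 1 / √(d^2-y^2) with hg
  have hcont : ContinuousOn H (Icc 0 d) := by
    refine ContinuousOn.add (ContinuousOn.neg (ContinuousOn.log (by fun_prop) ?_))
      (continuous_arcsin.comp (by fun_prop)).continuousOn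
    intro y hy
    have : 0 < √(c^2-y^2) := Real.sqrt_pos.2 (by nlinarith [hy.1, hy.2])
    positivity
  have hderiv : ∀ y ∈ Ioo 0 d, HasDerivAt H (g y) y := by
    intro y ⟨h1, h2⟩
    have hP : 0 < c^2 - y^2 := by nlinarith
    have hQ : 0 < d^2 - y^2 := by nlinarith
    have sP := Real.sqrt_pos.2 hP
    have sQ := Real.sqrt_pos.2 hQ
    have a1 := ((hasDerivAt_pow 2 y).const_sub (c^2)).sqrt hP.ne'
    have a2 := ((hasDerivAt_pow 2 y).const_sub (d^2)).sqrt hQ.ne'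
    have a3 := ((a1.add a2).log (by simp only [Pi.add_apply]; positivity)).neg
    have e1 : y/d ≠ -1 := by intro h; rw [div_eq_iff hd.ne'] at h; linarith
    have e2 : y/d ≠ 1 := by intro h; rw [div_eq_iff hd.ne'] at h; linarith
    have a4 := (hasDerivAt_arcsin e1 e2).comp y ((hasDerivAt_id y).div_const d)
    have e3 : 1 - (y/d)^2 = (d^2-y^2) * (1/d)^2 := by field_simp
    rw [e3, Real.sqrt_mul hQ.le, Real.sqrt_sq (by positivity)] at a4
    have a5 := a3.add a4
    refine HasDerivAt.congr_deriv (f := H) a5 ?_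
    simp only [hg, Pi.add_apply]
    generalize √(c^2-y^2) = A at *
    generalize √(d^2-y^2) = B at *
    have : A + B ≠ 0 := by positivity
    field_simp
    push_cast
    ring
  have hpos : ∀ y ∈ Ioo 0 d, 0 ≤ g y := by
    intro y hy
    have : 0 < y := hy.1
    simp only [hg]; positivity
  have hgi := intervalIntegral.integrableOn_deriv_of_nonneg hcont hderiv hpos
  have hgi' : IntervalIntegrable g volume 0 d := (intervalIntegrable_iff_integrableOn_Ioc_of_le hd.le).2 hgi
  have hF := intervalIntegral.integral_eq_sub_of_hasDerivAt_of_le hd.le hcont hderiv hgi'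
  have v1 : H d = - log (√(c^2-d^2)) + π/2 := by
    simp [hH, hd.ne']
  have v2 : H 0 = - log (c+d) := by
    simp [hH, Real.sqrt_sq hc.le, Real.sqrt_sq hd.le]
  have hlog : log (c+d) ≤ log (2*c) := Real.log_le_log (by positivity) (by linarith)
  have hm : ∫ y in (0:ℝ)..d, c * (1 / Real.sqrt ((c^2 - y^2) * (d^2 - y^2))) ≤ ∫ y in (0:ℝ)..d, g y := by
    rw [intervalIntegral.integral_of_le hd.le, intervalIntegral.integral_of_le hd.le]
    refine integral_mono_of_nonneg (Filter.Eventually.of_forall fun y => by simp only [Pi.zero_apply]; positivity) hgi ?_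
    refine (ae_restrict_iff' measurableSet_Ioc).2 (Filter.Eventually.of_forall fun y hy => ?_)
    obtain ⟨h1, h2⟩ := hy
    have hP : 0 < c^2 - y^2 := by nlinarith
    have sP := Real.sqrt_pos.2 hP
    have key : c ≤ y + √(c^2-y^2) := by
      have : c - y ≤ √(c^2-y^2) := Real.le_sqrt_of_sq_le (by nlinarith)
      linarith
    simp only [hg]
    rw [Real.sqrt_mul hP.le]
    have e1 : c * (1 / (√(c^2-y^2) * √(d^2-y^2))) = (c/√(c^2-y^2)) * (√(d^2-y^2))⁻¹ := by
      rw [one_div, mul_inv]; ring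
    have e2 : y / (√(c^2-y^2) * √(d^2-y^2)) + 1 / √(d^2-y^2) = ((y + √(c^2-y^2))/√(c^2-y^2)) * (√(d^2-y^2))⁻¹ := by
      rw [add_div, div_self sP.ne', div_eq_mul_inv, mul_inv]; ring
    rw [e1, e2]
    gcongr
  rw [hF, intervalIntegral.integral_const_mul, v1, v2] at hm
  unfold I1
  linarith

open Real Set MeasureTheory in
lemma sqrt_bound (c d : ℝ) (hd : 0 < d) (hdc : d < c) :
    √(c^2-d^2) ≤ 2 * c * exp (π/2) * exp (tauStar c d / 8) := by
  have hc : 0 < c := hd.trans hdc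
  have hD : 0 < c^2 - d^2 := by nlinarith
  have h0 := I0_lower c d hd hdc
  have h1 := I1_upper c d hd hdc
  have hS := Real.sqrt_pos.2 hD
  have h1n : 0 ≤ I1 c d := intervalIntegral.integral_nonneg hd.le fun y _ => by positivity
  have hI0 : 0 < I0 c d := by
    have : 0 < c * I0 c d := lt_of_lt_of_le (by positivity) h0
    exact pos_of_mul_pos_right this hc.le
  have ht : - (c * I1 c d) ≤ tauStar c d / 8 := by
    unfold tauStar
    rw [div_div, le_div_iff₀ (by positivity)]
    nlinarith [mul_le_mul_of_nonneg_right h0 h1n]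
  have : log (√(c^2-d^2)) ≤ log (2*c) + π/2 + tauStar c d / 8 := by linarith
  calc √(c^2-d^2) = exp (log (√(c^2-d^2))) := (exp_log hS).symm
    _ ≤ exp (log (2*c) + π/2 + tauStar c d / 8) := exp_le_exp.2 this
    _ = _ := by rw [exp_add, exp_add, exp_log (by positivity)]

lemma summable_gauss : Summable fun m : ℤ => Real.exp (2 - |(m:ℝ)|) := by
  have h : Summable fun n : ℕ => Real.exp (2 - (n:ℝ)) := by
    simp_rw [sub_eq_add_neg, Real.exp_add]
    exact Real.summable_exp_neg_nat.mul_left _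
  apply Summable.of_nat_of_neg <;> simpa using h

lemma int_sq_le (m : ℤ) : |(m:ℝ)| ≤ (m:ℝ)^2 := by
  rw [← sq_abs]
  rcases eq_or_ne m 0 with rfl | h
  · simp
  · have : (1:ℝ) ≤ |(m:ℝ)| := by exact_mod_cast Int.one_le_abs h
    nlinarith

lemma int_shift_nonneg (m : ℤ) (z : ℝ) (h1 : -1/2 ≤ z) (h2 : z ≤ 1/2) :
    0 ≤ ((m:ℝ)+1/2)*((m:ℝ)+1/2+z) := by
  rcases le_or_gt 0 m with h | h
  · have : (0:ℝ) ≤ m := by exact_mod_cast h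
    exact mul_nonneg (by linarith) (by linarith)
  · have : (m:ℝ) ≤ -1 := by exact_mod_cast (by omega : m ≤ -1)
    exact mul_nonneg_of_nonpos_of_nonpos (by linarith) (by linarith)

lemma theta_den (τ z : ℝ) (hτ : τ < -4) (h1 : -1/2 ≤ z) (h2 : z ≤ 1/2) :
    1 ≤ ThetaR (τ*z/2) τ := by
  have hs : Summable fun m : ℤ => Real.exp (τ * (m : ℝ)^2 / 2 + (τ*z/2) * m) := by
    refine Summable.of_nonneg_of_le (fun m => (Real.exp_pos _).le) (fun m => ?_) summable_gauss
    apply Real.exp_le_exp.2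
    have a := int_sq_le m
    have b : -(|(m:ℝ)|/2) ≤ z * m := by
      have : |z * m| ≤ 1/2 * |(m:ℝ)| := by
        rw [abs_mul]; exact mul_le_mul_of_nonneg_right (abs_le.2 ⟨by linarith, h2⟩) (abs_nonneg _)
      linarith [neg_abs_le (z*m)]
    have e : |(m:ℝ)|/2 ≤ (m:ℝ)^2 + z*m := by linarith
    have : τ * ((m:ℝ)^2 + z*m) ≤ (-4) * (|(m:ℝ)|/2) := by
      nlinarith [abs_nonneg (m:ℝ)]
    linarith
  have := hs.le_tsum 0 (fun m _ => (Real.exp_pos _).le)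
  simpa [ThetaR] using this

lemma theta_num (τ z : ℝ) (hτ : τ < -4) (h1 : -1/2 ≤ z) (h2 : z ≤ 1/2) :
    Real.exp (-τ/8 + τ*(z+1)/4) * ThetaR (τ*(z+1)/2) τ ≤ ∑' m : ℤ, Real.exp (2 - |(m:ℝ)|) := by
  unfold ThetaR
  rw [← tsum_mul_left]
  have hle : ∀ m : ℤ, Real.exp (-τ/8 + τ*(z+1)/4) * Real.exp (τ * (m : ℝ)^2 / 2 + (τ*(z+1)/2) * m)
      ≤ Real.exp (2 - |(m:ℝ)|) := by
    intro m
    rw [← Real.exp_add]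
    apply Real.exp_le_exp.2
    have e : -τ/8 + τ*(z+1)/4 + (τ * (m : ℝ)^2 / 2 + (τ*(z+1)/2) * m)
      = τ / 2 * (((m:ℝ)+1/2)*((m:ℝ)+1/2+z)) := by ring
    rw [e]
    have a := int_shift_nonneg m z h1 h2
    have b : |(m:ℝ)|/2 - 1 ≤ ((m:ℝ)+1/2)*((m:ℝ)+1/2+z) := by
      have : |z * (m+1/2)| ≤ 1/2 * (|(m:ℝ)| + 1/2) := by
        rw [abs_mul]
        refine mul_le_mul (abs_le.2 ⟨by linarith, h2⟩) ?_ (abs_nonneg _) (by norm_num)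
        refine (abs_add_le _ _).trans ?_
        norm_num
      have h3 := neg_abs_le (z*(m+1/2))
      have h4 := neg_abs_le (m:ℝ)
      have h5 := sq_abs (m:ℝ)
      nlinarith [sq_nonneg (|(m:ℝ)|-1)]
    nlinarith
  refine Summable.tsum_le_tsum hle ?_ summable_gauss
  exact Summable.of_nonneg_of_le (fun m => by positivity) hle summable_gauss

theorem stmt5 (c : ℝ) (hc : 0 < c) (h : ℝ → ℝ)
    (hinv : ∀ s : ℝ, s < 0 → h s ∈ Set.Ioo 0 c ∧ tauStar c (h s) = s)
    (hinv' : ∀ d ∈ Set.Ioo (0:ℝ) c, h (tauStar c d) = d) :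
    ∃ C > 0, ∃ T₀ < 0, ∀ τ : ℝ, τ < T₀ → ∀ z ∈ Set.Icc (-1/2 : ℝ) (1/2),
      |Ffun c h τ z| ≤ C * Real.exp (τ/8) := by
  have hM : 0 < ∑' m : ℤ, Real.exp (2 - |(m:ℝ)|) :=
    summable_gauss.tsum_pos (fun m => (Real.exp_pos _).le) 0 (Real.exp_pos _)
  refine ⟨2 * c * Real.exp (Real.pi/2) * ∑' m : ℤ, Real.exp (2 - |(m:ℝ)|), by positivity, -4, by norm_num, ?_⟩
  intro τ hτ z ⟨h1, h2⟩
  obtain ⟨⟨hd, hdc⟩, ht⟩ := hinv τ (by linarith)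
  have hS := sqrt_bound c (h τ) hd hdc
  rw [ht] at hS
  have hden := theta_den τ z hτ h1 h2
  have hnum := theta_num τ z hτ h1 h2
  have hn0 : 0 ≤ ThetaR (τ*(z+1)/2) τ := tsum_nonneg fun m => (Real.exp_pos _).le
  unfold Ffun
  rw [abs_of_nonneg (by positivity)]
  refine (div_le_self (by positivity) hden).trans ?_
  rw [mul_assoc]
  refine (mul_le_mul hS hnum (by positivity) (by positivity)).trans (le_of_eq (by ring))
end

section
/- Let c>0 and set η=1−d/c, i.e. d=c(1−η). Then τ*(c(1−η)) = −4·log(8/η) + O(η) as η→0⁺; that is, there exist constants C>0 and η₀>0 such that |τ*(c(1−η)) + 4·log(8/η)| ≤ C·η for all 0<η<η₀. -/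
open Real Set MeasureTheory
lemma covPos (f f' g h : ℝ → ℝ) (a b : ℝ) (hab : a < b) (hf : Continuous f)
    (hd : ∀ x ∈ Ioo a b, HasDerivAt f (f' x) x) (hp : ∀ x ∈ Ioo a b, 0 ≤ f' x)
    (he : ∀ x ∈ Ioo a b, f' x * g (f x) = h x) (hh : Continuous h) :
    IntervalIntegrable g volume (f a) (f b) ∧ ∫ x in (f a)..(f b), g x = ∫ x in a..b, h x := by
  have e1 : min a b = a := min_eq_left hab.le
  have e2 : max a b = b := max_eq_right hab.le
  constructor
  · rw [← intervalIntegral.integrable_deriv_smul_comp_iff_of_deriv_nonneg (f' := f') hf.continuousOn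
      (by rwa [e1, e2]) (by rwa [e1, e2])]
    refine IntervalIntegrable.congr_uIoo (hh.intervalIntegrable a b) ?_
    intro x hx
    rw [uIoo_of_lt hab] at hx
    simp [he x hx]
  · rw [← intervalIntegral.integral_deriv_smul_comp_of_deriv_nonneg (f' := f') hf.continuousOn
      (by rwa [e1, e2]) (by rwa [e1, e2])]
    apply intervalIntegral.integral_congr_uIoo
    intro x hx
    rw [uIoo_of_lt hab] at hx
    simp [he x hx]

lemma covNeg (f f' g h : ℝ → ℝ) (a b : ℝ) (hab : a < b) (hf : Continuous f)
    (hd : ∀ x ∈ Ioo a b, HasDerivAt f (f' x) x) (hp : ∀ x ∈ Ioo a b, f' x ≤ 0)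
    (he : ∀ x ∈ Ioo a b, f' x * g (f x) = - h x) (hh : Continuous h) :
    IntervalIntegrable g volume (f b) (f a) ∧ ∫ x in (f b)..(f a), g x = ∫ x in a..b, h x := by
  have e1 : min a b = a := min_eq_left hab.le
  have e2 : max a b = b := max_eq_right hab.le
  constructor
  · apply IntervalIntegrable.symm
    rw [← intervalIntegral.integrable_deriv_smul_comp_iff_of_deriv_nonpos (f' := f') hf.continuousOn
      (by rwa [e1, e2]) (by rwa [e1, e2])]
    refine IntervalIntegrable.congr_uIoo (hh.neg.intervalIntegrable a b) ?_
    intro x hx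
    rw [uIoo_of_lt hab] at hx
    simp [he x hx]
  · rw [intervalIntegral.integral_symm,
      ← intervalIntegral.integral_deriv_smul_comp_of_deriv_nonpos (f' := f') hf.continuousOn
      (by rwa [e1, e2]) (by rwa [e1, e2]), ← intervalIntegral.integral_neg]
    apply intervalIntegral.integral_congr_uIoo
    intro x hx
    rw [uIoo_of_lt hab] at hx
    simp [he x hx]

lemma I0_eq (c κ b : ℝ) (hc : 0 < c) (hκ : 0 < κ) (hb : 0 < b) (hbκ : κ^2 = 1 - b^2) :
    I0 c (c*κ) = 1/c * ∫ t in (0:ℝ)..(π/2), 1/√(1-b^2*sin t^2) := by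
  have hu : ∀ t, 0 < 1 - b^2*sin t^2 := fun t => by
    nlinarith [sin_sq_le_one t, sq_nonneg b, pow_pos hκ 2]
  have hq : ∀ t, 0 < √(1 - b^2*sin t^2) := fun t => sqrt_pos.2 (hu t)
  have hc1 : Continuous fun t : ℝ => 1/c * (1/√(1-b^2*sin t^2)) :=
    continuous_const.mul (Continuous.div (by fun_prop) (by fun_prop) (fun t => (hq t).ne'))
  have hsc : ∀ x ∈ Ioo 0 (π/2), 0 < sin x ∧ 0 < cos x := fun x hx =>
    ⟨sin_pos_of_pos_of_lt_pi hx.1 (by linarith [hx.2, pi_pos]),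
      cos_pos_of_mem_Ioo ⟨by linarith [hx.1, pi_pos], hx.2⟩⟩
  have key := covNeg (fun t => c*√(1-b^2*sin t^2))
    (fun t => -(c*b^2*sin t*cos t/√(1-b^2*sin t^2)))
    (fun y => 1 / √((c^2 - y^2) * (y^2 - (c*κ)^2))) _ 0 (π/2) (by positivity) (by fun_prop)
    (by
      intro x _
      have h1 : HasDerivAt (fun t => 1 - b^2*sin t^2) (-(b^2*(2*sin x*cos x))) x := by
        have := (((hasDerivAt_sin x).pow 2).const_mul (b^2)).const_sub 1
        simpa using! this
      refine ((h1.sqrt (hu x).ne').const_mul c).congr_deriv ?_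
      have := hq x
      field_simp)
    (by
      intro x hx
      have := hsc x hx
      have := hq x
      have : 0 ≤ c*b^2*sin x*cos x/√(1-b^2*sin x^2) := by
        obtain ⟨h1, h2⟩ := hsc x hx
        positivity
      linarith)
    (by
      intro x hx
      obtain ⟨h1, h2⟩ := hsc x hx
      have h3 := hq x
      have h4 : (c^2 - (c*√(1-b^2*sin x^2))^2) * ((c*√(1-b^2*sin x^2))^2 - (c*κ)^2)
          = (c^2*b^2*sin x*cos x)^2 := by
        rw [mul_pow c, mul_pow c κ, sq_sqrt (hu x).le, hbκ]
        have := cos_sq' x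
        rw [mul_pow _ (cos x), this]
        ring
      simp only [h4]
      rw [sqrt_sq (by positivity)]
      field_simp) hc1
  have h0 : √(1 - b^2) = κ := by rw [← hbκ, sqrt_sq hκ.le]
  have := key.2
  simp only [sin_pi_div_two, sin_zero] at this
  simp only [one_pow, mul_one, h0, ne_eq, OfNat.ofNat_ne_zero, not_false_eq_true, zero_pow, mul_zero, sub_zero, sqrt_one, intervalIntegral.integral_const_mul] at this
  exact this

lemma I1_eq (c κ s : ℝ) (hc : 0 < c) (hκ : 0 < κ) (hs : 0 < s) (hsκ : κ^2 = 1 - s^4) :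
    I1 c (c*κ) = 2/c * ∫ t in (0:ℝ)..s, 1/(√(s^4+t^2)*√(1+t^2)) := by
  have hpos : ∀ t : ℝ, 0 < s^4+t^2 := fun t => by positivity
  have hpos' : ∀ t : ℝ, 0 < 1+t^2 := fun t => by positivity
  have hq : ∀ t : ℝ, 0 < √(s^4+t^2) := fun t => sqrt_pos.2 (hpos t)
  have hr : ∀ t : ℝ, 0 < √(1+t^2) := fun t => sqrt_pos.2 (by positivity)
  have hq2 : ∀ t : ℝ, √(s^4+t^2)^2 = s^4+t^2 := fun t => sq_sqrt (hpos t).le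
  have hr2 : ∀ t : ℝ, √(1+t^2)^2 = 1+t^2 := fun t => sq_sqrt (by positivity)
  have hc1 : Continuous fun t : ℝ => 1/c*(1/(√(s^4+t^2)*√(1+t^2))) :=
    continuous_const.mul (Continuous.div (by fun_prop) (by fun_prop) (fun t => by have := hq t; have := hr t; positivity))
  have key1 := covPos (fun t => c*κ*t/√(s^4+t^2))
    (fun t => c*κ*s^4/√(s^4+t^2)^3)
    (fun y => 1 / √((c^2 - y^2) * ((c*κ)^2 - y^2))) _ 0 s hs
    (Continuous.div (by fun_prop) (by fun_prop) (fun t => (hq t).ne'))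
    (by
      intro t _
      have h1 : HasDerivAt (fun t : ℝ => s^4+t^2) (2*t) t := by
        simpa using (hasDerivAt_pow 2 t).const_add (s^4)
      have h2 := h1.sqrt (hpos t).ne'
      refine (((hasDerivAt_id t).const_mul (c*κ)).div h2 (hq t).ne').congr_deriv ?_
      have h7 := hq t
      simp only [id]
      field_simp
      rw [hq2]; ring)
    (by intro t _; have := hq t; positivity)
    (by
      intro t _
      have h3 := hq t
      have h3' := hr t
      have h4 : (c^2 - (c*κ*t/√(s^4+t^2))^2) * ((c*κ)^2 - (c*κ*t/√(s^4+t^2))^2)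
          = (c^2*κ*s^4*√(1+t^2)/√(s^4+t^2)^2)^2 := by
        have e : (√(s^4+t^2)^2)^2 = (s^4+t^2)^2 := by rw [hq2]
        rw [div_pow, div_pow _ (√(s^4+t^2)^2), mul_pow _ (√(1+t^2)), hr2, hq2]
        have := hpos t
        field_simp
        rw [hsκ]; ring
      simp only [h4]
      rw [sqrt_sq (by positivity)]
      field_simp) hc1
  have key2 := covNeg (fun t => c*κ/√(1+t^2))
    (fun t => -(c*κ*t/√(1+t^2)^3))
    (fun y => 1 / √((c^2 - y^2) * ((c*κ)^2 - y^2))) _ 0 s hs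
    (Continuous.div (by fun_prop) (by fun_prop) (fun t => (hr t).ne'))
    (by
      intro t _
      have h1 : HasDerivAt (fun t : ℝ => 1+t^2) (2*t) t := by
        simpa using (hasDerivAt_pow 2 t).const_add 1
      have h2 := h1.sqrt (hpos' t).ne'
      refine ((hasDerivAt_const t (c*κ)).div h2 (hr t).ne').congr_deriv ?_
      have h7 := hr t
      field_simp
      ring)
    (by intro t ht; have := hr t; have := ht.1
        have : 0 ≤ c*κ*t/√(1+t^2)^3 := by positivity
        linarith)
    (by
      intro t ht
      have h0 := ht.1
      have h3 := hq t
      have h3' := hr t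
      have h4 : (c^2 - (c*κ/√(1+t^2))^2) * ((c*κ)^2 - (c*κ/√(1+t^2))^2)
          = (c^2*κ*t*√(s^4+t^2)/√(1+t^2)^2)^2 := by
        rw [div_pow, div_pow _ (√(1+t^2)^2), mul_pow _ (√(s^4+t^2)), hr2, hq2]
        have := hpos' t
        field_simp
        rw [hsκ]; ring
      simp only [h4]
      rw [sqrt_sq (by positivity)]
      field_simp) hc1
  have h2 : √(s^4+s^2) = s*√(1+s^2) := by
    rw [show s^4+s^2 = s^2*(1+s^2) by ring, sqrt_mul (by positivity), sqrt_sq hs.le]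
  have h3 : c*κ*s/√(s^4+s^2) = c*κ/√(1+s^2) := by
    rw [h2]; have := hr s; field_simp
  simp only [h3] at key1
  simp only [mul_zero, zero_div] at key1
  simp only [ne_eq, OfNat.ofNat_ne_zero, not_false_eq_true, zero_pow, add_zero, sqrt_one, div_one] at key2
  rw [I1, ← intervalIntegral.integral_add_adjacent_intervals key1.1 key2.1, key1.2, key2.2,
    intervalIntegral.integral_const_mul]
  ring

lemma rbound (r : ℝ) (hr : 1 ≤ r) : 1 - (r^2-1)/2 ≤ 1/r ∧ 1/r ≤ 1 - (r^2-1)/2 + 3/8*(r^2-1)^2 := by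
  have h0 : 0 < r := by linarith
  constructor
  · rw [le_div_iff₀ h0]
    nlinarith [mul_nonneg (sq_nonneg (r-1)) (by linarith : (0:ℝ) ≤ r+2)]
  · rw [div_le_iff₀ h0]
    have : 0 ≤ (r-1)^3*(3*r^2+9*r+8) := by
      have : 0 ≤ r - 1 := by linarith
      positivity
    nlinarith

lemma Mbound (s : ℝ) (hs : 0 < s) :
   let F := arsinh (1/s) * (1+s^4/4) - s^2 * √(1+s^2)/4
   F ≤ ∫ t in (0:ℝ)..s, 1/(√(s^4+t^2)*√(1+t^2)) ∧
   (∫ t in (0:ℝ)..s, 1/(√(s^4+t^2)*√(1+t^2))) ≤ F + s^4/8 := by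
  intro F
  have hpos : ∀ t : ℝ, 0 < s^4+t^2 := fun t => by positivity
  have hq : ∀ t : ℝ, 0 < √(s^4+t^2) := fun t => sqrt_pos.2 (hpos t)
  have hr : ∀ t : ℝ, 0 < √(1+t^2) := fun t => sqrt_pos.2 (by positivity)
  have hc1 : Continuous fun t : ℝ => 1/(√(s^4+t^2)*√(1+t^2)) :=
    Continuous.div (by fun_prop) (by fun_prop) (fun t => by have := hq t; have := hr t; positivity)
  have hc2 : Continuous fun t : ℝ => (1-t^2/2)/√(s^4+t^2) :=
    Continuous.div (by fun_prop) (by fun_prop) (fun t => (hq t).ne')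
  have hF : ∫ t in (0:ℝ)..s, (1-t^2/2)/√(s^4+t^2) = F := by
    have hd : ∀ t ∈ uIcc 0 s, HasDerivAt (fun t : ℝ => arsinh (t/s^2) * (1+s^4/4) - t * √(s^4+t^2)/4) ((1-t^2/2)/√(s^4+t^2)) t := by
      intro t _
      have h1 : HasDerivAt (fun t : ℝ => s^4+t^2) (2*t) t := by
        simpa using (hasDerivAt_pow 2 t).const_add (s^4)
      have h2 := h1.sqrt (hpos t).ne'
      have h3 := ((hasDerivAt_id t).div_const (s^2)).arsinh
      have h4 := (h3.mul_const (1+s^4/4)).sub (((hasDerivAt_id t).mul h2).div_const 4)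
      refine HasDerivAt.congr_deriv h4 ?_
      have h5 : √(1 + (id t / s^2)^2) = √(s^4+t^2)/s^2 := by
        rw [show 1 + (id t / s^2)^2 = (s^4+t^2)/(s^2)^2 by simp; field_simp]
        rw [sqrt_div (hpos t).le, sqrt_sq (by positivity)]
      rw [h5]
      have h6 := sq_sqrt (hpos t).le
      have h7 := hq t
      simp only [id, smul_eq_mul]
      field_simp
      rw [h6]; ring
    rw [intervalIntegral.integral_eq_sub_of_hasDerivAt hd (hc2.intervalIntegrable _ _)]
    have h1 : s/s^2 = 1/s := by field_simp
    have h2 : √(s^4+s^2) = s*√(1+s^2) := by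
      rw [show s^4+s^2 = s^2*(1+s^2) by ring, sqrt_mul (by positivity), sqrt_sq hs.le]
    simp only [h1, h2, F]; simp; ring
  have hrb := fun t : ℝ => rbound (√(1+t^2)) (by rw [le_sqrt] <;> nlinarith [sq_nonneg t])
  have hsq : ∀ t:ℝ, √(1+t^2)^2 = 1+t^2 := fun t => sq_sqrt (by positivity)
  constructor
  · rw [← hF]
    apply intervalIntegral.integral_mono_on hs.le (hc2.intervalIntegrable _ _) (hc1.intervalIntegrable _ _)
    intro t _
    have := (hrb t).1
    rw [hsq] at this
    rw [mul_comm, ← div_div]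
    apply div_le_div_of_nonneg_right _ (hq t).le
    linarith
  · have hI : ∫ t in (0:ℝ)..s, ((1-t^2/2)/√(s^4+t^2) + 3/8*t^3) = F + 3/32*s^4 := by
      rw [intervalIntegral.integral_add (hc2.intervalIntegrable _ _) (Continuous.intervalIntegrable (by fun_prop) _ _), hF]
      simp; ring
    have : F + 3/32*s^4 ≤ F + s^4/8 := by nlinarith [pow_pos hs 4]
    refine le_trans ?_ this
    rw [← hI]
    apply intervalIntegral.integral_mono_on hs.le (hc1.intervalIntegrable _ _) (Continuous.intervalIntegrable (by fun_prop) _ _)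
    intro t ht
    have := (hrb t).2
    rw [hsq] at this
    have ht0 : 0 ≤ t := ht.1
    have h8 : t ≤ √(s^4+t^2) := by apply le_sqrt_of_sq_le; nlinarith [pow_pos hs 4]
    rw [mul_comm, ← div_div, div_le_iff₀ (hq t), add_mul, div_mul_cancel₀ _ (hq t).ne']
    have : 3/8*t^3*t ≤ 3/8*t^3*√(s^4+t^2) := by gcongr
    nlinarith

lemma ubound (u : ℝ) (h0 : 0 ≤ u) (h1 : u ≤ 1/2) : 1 + u/2 ≤ 1/√(1-u) ∧ 1/√(1-u) ≤ 1+u/2+u^2 := by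
  have hp : 0 < √(1-u) := sqrt_pos.2 (by linarith)
  have hs : √(1-u)^2 = 1-u := sq_sqrt (by linarith)
  constructor
  · rw [le_div_iff₀ hp]
    apply le_of_pow_le_pow_left₀ two_ne_zero (by norm_num)
    rw [mul_pow, hs]
    nlinarith [mul_nonneg h0 h0, mul_nonneg (mul_nonneg h0 h0) h0]
  · rw [div_le_iff₀ hp]
    apply le_of_pow_le_pow_left₀ two_ne_zero (by positivity)
    rw [mul_pow, hs]
    have : (0:ℝ) ≤ u^2*(1/2-u) := by have : 0 ≤ 1/2-u := by linarith
                                     positivity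
    have : (0:ℝ) ≤ u^3*(1/2-u) := by have : 0 ≤ 1/2-u := by linarith
                                     positivity
    have : (0:ℝ) ≤ u^4*(1/2-u) := by have : 0 ≤ 1/2-u := by linarith
                                     positivity
    nlinarith [sq_nonneg u, pow_nonneg h0 3, pow_nonneg h0 4]

lemma Kbound (b : ℝ) (hb : b^2 ≤ 1/2) :
   π/2*(1+b^2/4) ≤ ∫ t in (0:ℝ)..(π/2), 1/√(1-b^2*sin t^2) ∧
   (∫ t in (0:ℝ)..(π/2), 1/√(1-b^2*sin t^2)) ≤ π/2*(1+b^2/4+b^4) := by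
  have hu : ∀ t, b^2*sin t^2 ≤ b^2 := fun t => by nlinarith [sin_sq_le_one t, sq_nonneg b]
  have hu0 : ∀ t, 0 ≤ b^2*sin t^2 := fun t => by positivity
  have hc1 : Continuous fun t : ℝ => 1/√(1-b^2*sin t^2) :=
    Continuous.div (by fun_prop) (by fun_prop) (fun t => (sqrt_pos.2 (by linarith [hu t])).ne')
  have hpi := pi_pos
  constructor
  · have hI : ∫ t in (0:ℝ)..(π/2), (1 + b^2*sin t^2/2) = π/2*(1+b^2/4) := by
      rw [intervalIntegral.integral_add (Continuous.intervalIntegrable (by fun_prop) _ _) (Continuous.intervalIntegrable (by fun_prop) _ _)]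
      simp [integral_sin_sq]; ring
    rw [← hI]
    apply intervalIntegral.integral_mono_on (by positivity) (Continuous.intervalIntegrable (by fun_prop) _ _) (hc1.intervalIntegrable _ _)
    intro t _
    exact (ubound _ (hu0 t) (by linarith [hu t])).1
  · have hI : ∫ t in (0:ℝ)..(π/2), (1 + b^2*sin t^2/2 + b^4) = π/2*(1+b^2/4+b^4) := by
      rw [intervalIntegral.integral_add (Continuous.intervalIntegrable (by fun_prop) _ _) (Continuous.intervalIntegrable (by fun_prop) _ _),
        intervalIntegral.integral_add (Continuous.intervalIntegrable (by fun_prop) _ _) (Continuous.intervalIntegrable (by fun_prop) _ _)]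
      simp [integral_sin_sq]; ring
    rw [← hI]
    apply intervalIntegral.integral_mono_on (by positivity) (hc1.intervalIntegrable _ _) (Continuous.intervalIntegrable (by fun_prop) _ _) 
    intro t _
    refine (ubound _ (hu0 t) (by linarith [hu t])).2.trans ?_
    have : (b^2*sin t^2)^2 ≤ (b^2)^2 := pow_le_pow_left₀ (hu0 t) (hu t) 2
    nlinarith

lemma Xbound (s η : ℝ) (hs : 0 < s) (hη : 0 < η) (hη1 : η < 1/4) (he : s^4 = η*(2-η)) :
    |4 * arsinh (1/s) - log (8/η) - s^2*√(1+s^2)| ≤ 4*η ∧ s^2*√(1+s^2) ≤ 2 := by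
  set w := √(1+s^2) with hw
  have hw2 : w^2 = 1+s^2 := sq_sqrt (by positivity)
  have hs1 : s^2 ≤ 1 := by nlinarith
  have hw1 : 1 ≤ w := by rw [hw, le_sqrt] <;> nlinarith
  have hwl : w ≤ 2 := by nlinarith
  have hA : 4 * arsinh (1/s) = 4*log (1+(w-1)/2) + 4*log 2 - log (s^4) := by
    have h1 : √(1+(1/s)^2) = w/s := by
      rw [show 1+(1/s)^2 = (1+s^2)/s^2 by field_simp; ring, sqrt_div (by positivity), sqrt_sq hs.le]
    rw [arsinh, h1, show 1/s + w/s = (1+(w-1)/2)*2/s by field_simp; ring,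
      log_div (by positivity) hs.ne', log_mul (by positivity) (by norm_num), log_pow]
    push_cast; ring
  have hL : log (8/η) = 4*log 2 + log (1-η/2) - log (s^4) := by
    have h2 : (0:ℝ) < 1-η/2 := by linarith
    have h3 : (2-η) ≠ 0 := by linarith
    rw [he, show 8/η = 2^4*(1-η/2)/(η*(2-η)) by field_simp; ring,
      log_div (by positivity) (by positivity), log_mul (by positivity) h2.ne', log_pow]
    push_cast; ring
  have l1 : log (1+(w-1)/2) ≤ (w-1)/2 := by
    have := log_le_sub_one_of_pos (show 0 < 1+(w-1)/2 by linarith)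
    linarith
  have l2 : (w-1)/2 - ((w-1)/2)^2 ≤ log (1+(w-1)/2) := by
    have hp : 0 < 1+(w-1)/2 := by linarith
    refine le_trans ?_ (one_sub_inv_le_log_of_pos hp)
    have : (1+(w-1)/2)⁻¹ ≤ 1 - (w-1)/2 + ((w-1)/2)^2 := by
      rw [inv_le_iff_one_le_mul₀ hp]
      nlinarith [pow_nonneg (show 0 ≤ (w-1)/2 by linarith) 3]
    linarith
  have m1 : log (1-η/2) ≤ 0 := log_nonpos (by linarith) (by linarith)
  have m2 : -η ≤ log (1-η/2) := by
    have hp : 0 < 1-η/2 := by linarith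
    refine le_trans ?_ (one_sub_inv_le_log_of_pos hp)
    have : (1-η/2)⁻¹ ≤ 1+η := by
      rw [inv_le_iff_one_le_mul₀ hp]
      nlinarith
    linarith
  have hww : (w-1)^2 ≤ s^4/4 := by
    have h1 : w - 1 ≤ s^2/2 := by nlinarith
    calc (w-1)^2 ≤ (s^2/2)^2 := pow_le_pow_left₀ (by linarith) h1 2
      _ = s^4/4 := by ring
  have hw3 : (w-1)^2*(w+2) ≤ s^4 := by
    nlinarith [mul_nonneg (sq_nonneg (w-1)) (show 0 ≤ 2-w by linarith)]
  have hid : 2*(w-1) - s^2*w = -((w-1)^2*(w+2)) := by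
    rw [show s^2 = w^2-1 by linarith]; ring
  have hn : 0 ≤ (w-1)^2*(w+2) := by positivity
  have hs4 : s^4 ≤ 2*η := by nlinarith
  refine ⟨?_, by nlinarith⟩
  rw [hA, hL, abs_le]
  constructor <;> nlinarith

theorem stmt6 (c : ℝ) (hc : 0 < c) :
    ∃ C > 0, ∃ η₀ > 0, ∀ η : ℝ, 0 < η → η < η₀ →
      |tauStar c (c * (1 - η)) + 4 * Real.log (8/η)| ≤ C * η := by
  refine ⟨400, by norm_num, 1/4, by norm_num, ?_⟩
  intro η h0 h1
  have hepos : 0 < η*(2-η) := by nlinarith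
  obtain ⟨s, hs, he⟩ : ∃ s : ℝ, 0 < s ∧ s^4 = η*(2-η) := by
    refine ⟨√√(η*(2-η)), sqrt_pos.2 (sqrt_pos.2 hepos), ?_⟩
    rw [show ∀ x : ℝ, x^4 = (x^2)^2 by intro x; ring, sq_sqrt (sqrt_nonneg _), sq_sqrt hepos.le]
  have hκ : 0 < 1-η := by linarith
  have hsκ : (1-η)^2 = 1 - s^4 := by rw [he]; ring
  have hs4 : s^4 ≤ 2*η := by nlinarith
  obtain ⟨hX, hw⟩ := Xbound s η hs h0 h1 he
  obtain ⟨hM1, hM2⟩ := Mbound s hs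
  obtain ⟨hK1, hK2⟩ := Kbound (s^2) (by rw [← pow_mul]; norm_num; linarith)
  rw [tauStar, I1_eq c (1-η) s hc hκ hs hsκ,
    I0_eq c (1-η) (s^2) hc hκ (by positivity) (by rw [hsκ]; ring)]
  have hL0 : 0 ≤ log (8/η) := log_nonneg (by rw [le_div_iff₀ h0]; linarith)
  have hL1 : log (8/η) ≤ 8/η := (log_le_sub_one_of_pos (by positivity)).trans (by linarith)
  have hLη : η * log (8/η) ≤ 8 := by
    calc η * log (8/η) ≤ η * (8/η) := by gcongr
      _ = 8 := by field_simp
  generalize (∫ t in (0:ℝ)..s, 1/(√(s^4+t^2)*√(1+t^2))) = M at *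
  generalize (∫ t in (0:ℝ)..(π/2), 1/√(1-(s^2)^2*sin t^2)) = K at *
  generalize log (8/η) = L at *
  generalize arsinh (1/s) = A at *
  have hv0 : 0 ≤ s^2*√(1+s^2) := by positivity
  generalize s^2*√(1+s^2) = v at *
  rw [show (s^2)^2 = s^4 by ring] at hK1 hK2
  rw [show (s^2)^4 = (s^4)^2 by ring] at hK2
  generalize s^4 = e at *
  have hp1 : 1 ≤ π/2 := by linarith [pi_gt_three]
  have hp2 : π/2 ≤ 2 := by linarith [pi_lt_four]
  have hpi : π = 2*(π/2) := by ring
  generalize π/2 = p at *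
  rw [hpi]
  have he0 : 0 < e := by rw [he]; exact hepos
  have hKp : 1 ≤ K := by nlinarith
  have heq : -4*(2*p)*(2/c*M)/(1/c*K) + 4*L = 4*(K*L - 4*p*M)/K := by
    have : K ≠ 0 := by linarith
    field_simp; ring
  rw [heq, abs_div, abs_of_pos (show 0 < K by linarith), div_le_iff₀ (by linarith)]
  suffices h : |K*L - 4*p*M| ≤ 100*η by
    rw [abs_mul, abs_of_pos (show (0:ℝ) < 4 by norm_num)]
    nlinarith
  -- main estimate
  obtain ⟨hX1, hX2⟩ := abs_le.1 hX
  have hKL1 : p*(1+e/4)*L ≤ K*L := mul_le_mul_of_nonneg_right hK1 hL0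
  have hKL2 : K*L ≤ p*(1+e/4+e^2)*L := mul_le_mul_of_nonneg_right hK2 hL0
  have heL : e^2*L ≤ 32*η := by
    calc e^2*L ≤ (2*η)^2*L := by gcongr
      _ = 4*η*(η*L) := by ring
      _ ≤ 4*η*8 := by gcongr
      _ = 32*η := by ring
  have hXe1 : e*(4*A-L) ≤ 2*η*3 := by
    calc e*(4*A-L) ≤ e*3 := by gcongr; linarith
      _ ≤ 2*η*3 := by gcongr
  have hXe2 : -(2*η*3) ≤ e*(4*A-L) := by
    have : e*(-3) ≤ e*(4*A-L) := by gcongr; linarith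
    linarith
  have hpM1 : p*(4*(A*(1+e/4) - v/4)) ≤ p*(4*M) := by gcongr
  have hpM2 : p*(4*M) ≤ p*(4*(A*(1+e/4) - v/4 + e/8)) := by gcongr
  have hup : p*(-(4*A-L-v) - e*(4*A-L)/4 + e^2*L) ≤ p*(50*η) := by gcongr; linarith
  have hlo : p*(-(50*η)) ≤ p*(-(4*A-L-v) - e*(4*A-L)/4 - e/2) := by gcongr; linarith
  have hpη : p*(50*η) ≤ 2*(50*η) := by gcongr
  rw [abs_le]
  constructor <;> linarith
end

section
/- Let c>0 and define Δ(d)=−I₂(d)/I₁(d) for 0<d<c. Then (1/π)·Δ(c(1−η)) = −(1/2)·(1 − 4·log2/log(1/η)) + O(1/log²η) as η→0⁺; that is, there exist constants C>0 and η₀>0 such that |(1/π)·Δ(c(1−η)) + (1/2)·(1 − 4·log2/log(1/η))| ≤ C/(log(1/η))² for all 0<η<η₀. -/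
/-- `I₂(d) = ∫_d^c log(c/(2√(c²−y²)))·dy/√((c²−y²)(y²−d²))`. -/
noncomputable def I2 (c d : ℝ) : ℝ :=
  ∫ y in d..c, Real.log (c / (2 * Real.sqrt (c^2 - y^2))) /
    Real.sqrt ((c^2 - y^2) * (y^2 - d^2))

/-- `Δ(d) = −I₂(d)/I₁(d)`. -/
noncomputable def Delta (c d : ℝ) : ℝ := -(I2 c d) / I1 c d

open Real Set MeasureTheory in
theorem aux_I1_eq (c k : ℝ) (hc : 0 < c) (hk : 0 < k) (hk1 : k < 1) :
    c * I1 c (c * k) = ∫ t in (0:ℝ)..(π/2), 1 / √(1 - k^2 * sin t ^ 2) := by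
  have hpi : (0:ℝ) < π / 2 := by positivity
  have hck : 0 < c * k := by positivity
  have himg : (fun t => c * k * sin t) '' (Ioo 0 (π/2)) = Ioo 0 (c * k) := by
    ext y
    constructor
    · rintro ⟨t, ⟨h0, h1⟩, rfl⟩
      have hs : 0 < sin t := sin_pos_of_pos_of_lt_pi h0 (by linarith)
      have hs1 : sin t < 1 := by
        rw [← sin_pi_div_two]
        exact sin_lt_sin_of_lt_of_le_pi_div_two (by linarith) le_rfl h1
      exact ⟨by positivity, by nlinarith⟩
    · rintro ⟨h0, h1⟩
      have q0 : 0 < y / (c * k) := by positivity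
      have q1 : y / (c * k) < 1 := by rw [div_lt_one hck]; exact h1
      refine ⟨arcsin (y / (c * k)), ⟨arcsin_pos.2 q0, arcsin_lt_pi_div_two.2 q1⟩, ?_⟩
      simp only
      rw [sin_arcsin (by linarith) q1.le]
      field_simp
  have hinj : InjOn (fun t => c * k * sin t) (Ioo 0 (π/2)) := by
    intro a ha b hb hab
    have : sin a = sin b := mul_left_cancel₀ hck.ne' hab
    exact injOn_sin ⟨by linarith [ha.1], ha.2.le⟩ ⟨by linarith [hb.1], hb.2.le⟩ this
  have hd : ∀ t ∈ Ioo 0 (π/2), HasDerivWithinAt (fun t => c * k * sin t) (c * k * cos t)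
      (Ioo 0 (π/2)) t := fun t _ => ((hasDerivAt_sin t).const_mul (c * k)).hasDerivWithinAt
  have key := integral_image_eq_integral_abs_deriv_smul measurableSet_Ioo hd hinj
    (fun y => 1 / √((c^2 - y^2) * ((c*k)^2 - y^2)))
  rw [himg] at key
  rw [I1, intervalIntegral.integral_of_le hck.le, integral_Ioc_eq_integral_Ioo, key,
    intervalIntegral.integral_of_le hpi.le, integral_Ioc_eq_integral_Ioo, ← integral_const_mul]
  refine setIntegral_congr_fun measurableSet_Ioo ?_
  rintro t ⟨h0, h1⟩
  have hcos : 0 < cos t := cos_pos_of_mem_Ioo ⟨by linarith, h1⟩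
  have hA : 0 < 1 - k^2 * sin t ^ 2 := by nlinarith [sin_sq_add_cos_sq t, sq_nonneg (sin t), sq_nonneg (cos t)]
  have e : (c^2 - (c * k * sin t)^2) * ((c*k)^2 - (c * k * sin t)^2)
      = (c * (c * k * cos t))^2 * (1 - k^2 * sin t ^ 2) := by
    have : cos t ^ 2 = 1 - sin t ^ 2 := by linarith [sin_sq_add_cos_sq t]
    simp only [mul_pow]
    rw [this]; ring
  have hp : 0 < c * k * cos t := by positivity
  simp only [smul_eq_mul]
  rw [e, sqrt_mul (sq_nonneg _), sqrt_sq (by positivity), abs_of_pos hp]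
  have := sqrt_pos.2 hA
  field_simp

open Real Set MeasureTheory in
theorem aux_I2_eq (c k b : ℝ) (hc : 0 < c) (hk : 0 < k) (hb : 0 < b) (hkb : k^2 + b^2 = 1) :
    c * I2 c (c * k) = ∫ t in (0:ℝ)..(π/2),
      (log (1 / (2 * b)) - log (sin t)) * (1 / √(1 - b^2 * sin t ^ 2)) := by
  have hpi : (0:ℝ) < π / 2 := by positivity
  have hk1 : k < 1 := by nlinarith
  have hck : 0 < c * k := by positivity
  have hlt : c * k < c := by nlinarith
  have hA : ∀ t, 0 < 1 - b^2 * sin t ^ 2 := fun t => by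
    nlinarith [sin_sq_add_cos_sq t, sq_nonneg (sin t), sq_nonneg (cos t), pow_pos hb 2, pow_pos hk 2]
  have hsc : ∀ t ∈ Ioo 0 (π/2), 0 < sin t ∧ sin t < 1 ∧ 0 < cos t := by
    rintro t ⟨h0, h1⟩
    refine ⟨sin_pos_of_pos_of_lt_pi h0 (by linarith), ?_, cos_pos_of_mem_Ioo ⟨by linarith, h1⟩⟩
    rw [← sin_pi_div_two]
    exact sin_lt_sin_of_lt_of_le_pi_div_two (by linarith) le_rfl h1
  have himg : (fun t => c * √(1 - b^2 * sin t ^ 2)) '' (Ioo 0 (π/2)) = Ioo (c * k) c := by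
    ext y
    constructor
    · rintro ⟨t, ht, rfl⟩
      obtain ⟨s0, s1, -⟩ := hsc t ht
      have hs2 : sin t ^ 2 < 1 := by nlinarith
      have hs3 : 0 < sin t ^ 2 := by positivity
      constructor
      · refine mul_lt_mul_of_pos_left ?_ hc
        apply lt_sqrt_of_sq_lt
        nlinarith [pow_pos hb 2]
      · have : √(1 - b^2 * sin t ^ 2) < 1 := by
          rw [sqrt_lt' one_pos]
          nlinarith [pow_pos hb 2, mul_pos (pow_pos hb 2) hs3]
        simp only
        nlinarith
    · rintro ⟨h0, h1⟩
      set z := y / c with hz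
      have hyz : y = c * z := by rw [hz]; field_simp
      have z0 : k < z := by rw [hyz] at h0; exact lt_of_mul_lt_mul_left h0 hc.le
      have z1 : z < 1 := by rw [hz, div_lt_one hc]; exact h1
      have w0 : 0 < 1 - z^2 := by nlinarith
      have q0 : 0 < √(1 - z^2) / b := by positivity
      have q1 : √(1 - z^2) / b < 1 := by
        rw [div_lt_one hb, sqrt_lt' hb]; nlinarith
      refine ⟨arcsin (√(1 - z^2) / b), ⟨arcsin_pos.2 q0, arcsin_lt_pi_div_two.2 q1⟩, ?_⟩
      simp only
      rw [sin_arcsin (by linarith) q1.le, div_pow, sq_sqrt w0.le, hyz]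
      have : 1 - b^2 * ((1 - z^2) / b^2) = z^2 := by field_simp; ring
      rw [this, sqrt_sq (by linarith)]
  have hinj : InjOn (fun t => c * √(1 - b^2 * sin t ^ 2)) (Ioo 0 (π/2)) := by
    intro x hx y hy hxy
    have h1 : √(1 - b^2 * sin x ^ 2) = √(1 - b^2 * sin y ^ 2) := mul_left_cancel₀ hc.ne' hxy
    rw [sqrt_inj (hA x).le (hA y).le] at h1
    have h2 : sin x ^ 2 = sin y ^ 2 := by
      have : b^2 * sin x ^ 2 = b^2 * sin y ^ 2 := by linarith
      exact mul_left_cancel₀ (pow_pos hb 2).ne' this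
    have h3 : sin x = sin y :=
      (pow_left_inj₀ (hsc x hx).1.le (hsc y hy).1.le two_ne_zero).1 h2
    exact injOn_sin ⟨by linarith [hx.1], hx.2.le⟩ ⟨by linarith [hy.1], hy.2.le⟩ h3
  have hd : ∀ t ∈ Ioo 0 (π/2), HasDerivWithinAt (fun t => c * √(1 - b^2 * sin t ^ 2))
      (-(c * (b^2 * sin t * cos t) / √(1 - b^2 * sin t ^ 2)))
      (Ioo 0 (π/2)) t := by
    intro t _
    have := ((((hasDerivAt_sin t).pow 2).const_mul (b^2)).const_sub 1).sqrt (hA t).ne'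
    have := (this.const_mul c).hasDerivWithinAt (s := Ioo 0 (π/2))
    convert! this using 1
    have := sqrt_pos.2 (hA t)
    simp only [Pi.pow_apply]
    field_simp
    norm_num
    ring
  have key := integral_image_eq_integral_abs_deriv_smul measurableSet_Ioo hd hinj
    (fun y => log (c / (2 * √(c^2 - y^2))) / √((c^2 - y^2) * (y^2 - (c*k)^2)))
  rw [himg] at key
  rw [I2, intervalIntegral.integral_of_le hlt.le, integral_Ioc_eq_integral_Ioo, key,
    intervalIntegral.integral_of_le hpi.le, integral_Ioc_eq_integral_Ioo, ← integral_const_mul]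
  refine setIntegral_congr_fun measurableSet_Ioo ?_
  intro t ht
  obtain ⟨s0, s1, c0⟩ := hsc t ht
  have hR := sqrt_pos.2 (hA t)
  have hR2 := sq_sqrt (hA t).le
  simp only [smul_eq_mul]
  set R := √(1 - b^2 * sin t ^ 2) with hRdef
  have e1 : c^2 - (c * R)^2 = (c * (b * sin t))^2 := by
    rw [mul_pow, hR2]; ring
  have e2 : (c * R)^2 - (c * k)^2 = (c * (b * cos t))^2 := by
    have h1 : cos t ^ 2 = 1 - sin t ^ 2 := by linarith [sin_sq_add_cos_sq t]
    have h2 : k^2 = 1 - b^2 := by linarith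
    simp only [mul_pow, hR2]
    rw [h1, h2]; ring
  have hp : 0 < c * (b^2 * sin t * cos t) / R := by positivity
  rw [e1, e2, abs_neg, abs_of_pos hp, ← mul_pow, sqrt_sq (by positivity), sqrt_sq (by positivity)]
  have e3 : c / (2 * (c * (b * sin t))) = (1 / (2 * b)) / sin t := by field_simp
  rw [e3, log_div (by positivity) s0.ne']
  field_simp

open Real Set MeasureTheory in
theorem aux_K (k b : ℝ) (hk : 0 < k) (hb : 0 < b) (hkb : k^2 + b^2 = 1) :
    |(∫ t in (0:ℝ)..(π/2), 1 / √(1 - k^2 * sin t ^ 2)) - (log 2 + (1/k) * log ((1 + k) / b))|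
      ≤ b * (π / 2) := by
  have hpi : (0:ℝ) < π / 2 := by positivity
  have hA : ∀ t, 0 < 1 - k^2 * sin t ^ 2 := fun t => by
    nlinarith [sin_sq_add_cos_sq t, sq_nonneg (sin t), sq_nonneg (cos t), pow_pos hb 2, pow_pos hk 2]
  have hAc : ∀ t, 1 - k^2 * sin t ^ 2 = b^2 + k^2 * cos t ^ 2 := fun t => by
    have : cos t ^ 2 = 1 - sin t ^ 2 := by linarith [sin_sq_add_cos_sq t]
    rw [this]; linear_combination -hkb
  have hs0 : ∀ t ∈ Icc 0 (π/2), 0 ≤ sin t := fun t ht =>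
    sin_nonneg_of_nonneg_of_le_pi ht.1 (by linarith [ht.2])
  have hc0 : ∀ t ∈ Icc 0 (π/2), 0 ≤ cos t := fun t ht =>
    cos_nonneg_of_mem_Icc ⟨by linarith [ht.1], ht.2⟩
  have hcont1 : Continuous (fun t => 1 / √(1 - k^2 * sin t ^ 2)) :=
    continuous_const.div (by fun_prop) (fun t => (sqrt_pos.2 (hA t)).ne')
  have hcont2 : ContinuousOn
      (fun t => cos t / (1 + sin t) + sin t / √(1 - k^2 * sin t ^ 2)) (uIcc 0 (π/2)) := by
    rw [uIcc_of_le hpi.le]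
    refine ContinuousOn.add (ContinuousOn.div (by fun_prop) (by fun_prop) ?_)
      (Continuous.continuousOn (continuous_sin.div (by fun_prop) (fun t => (sqrt_pos.2 (hA t)).ne')))
    intro t ht
    have := hs0 t ht
    positivity
  have hF : ∫ t in (0:ℝ)..(π/2), (cos t / (1 + sin t) + sin t / √(1 - k^2 * sin t ^ 2))
      = log 2 + (1/k) * log ((1 + k) / b) := by
    rw [intervalIntegral.integral_eq_sub_of_hasDerivAt
      (f := fun t => log (1 + sin t) - (1/k) * arsinh (k * cos t / b)) ?_ hcont2.intervalIntegrable]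
    · have h1 : arsinh (k / b) = log ((1 + k) / b) := by
        rw [arsinh]
        have : 1 + (k/b)^2 = (1/b)^2 := by field_simp; linarith
        rw [this, sqrt_sq (by positivity)]
        congr 1; ring
      simp [h1]
      norm_num
    · intro t ht
      rw [uIcc_of_le hpi.le] at ht
      have hs := hs0 t ht
      have d1 := ((hasDerivAt_sin t).const_add 1).log (by positivity)
      have d2 := ((((hasDerivAt_cos t).const_mul k).div_const b).arsinh).const_mul (1/k)
      convert! d1.sub d2 using 1
      have : √(1 + (k * cos t / b)^2) = √(1 - k^2 * sin t ^ 2) / b := by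
        rw [eq_div_iff hb.ne', hAc]
        nth_rw 2 [← sqrt_sq hb.le]
        rw [← sqrt_mul (by positivity)]
        congr 1; field_simp
      rw [this]
      have := sqrt_pos.2 (hA t)
      simp only [smul_eq_mul]
      field_simp
      ring
  rw [← hF, ← intervalIntegral.integral_sub (hcont1.intervalIntegrable _ _) hcont2.intervalIntegrable]
  have := intervalIntegral.norm_integral_le_of_norm_le_const (a := 0) (b := π/2) (C := b)
    (f := fun t => 1 / √(1 - k^2 * sin t ^ 2) - (cos t / (1 + sin t) + sin t / √(1 - k^2 * sin t ^ 2))) ?_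
  · rwa [sub_zero, abs_of_pos hpi] at this
  · intro t ht
    rw [uIoc_of_le hpi.le] at ht
    have ht' : t ∈ Icc 0 (π/2) := ⟨ht.1.le, ht.2⟩
    have s0 := hs0 t ht'
    have c0 := hc0 t ht'
    have hR := sqrt_pos.2 (hA t)
    have hR2 := sq_sqrt (hA t).le
    set R := √(1 - k^2 * sin t ^ 2) with hRdef
    have hsq := sin_sq_add_cos_sq t
    have hxR : cos t ≤ R := by
      apply le_sqrt_of_sq_le
      nlinarith [mul_nonneg (sq_nonneg b) (sq_nonneg (sin t))]
    have hRx : R ≤ cos t + b := by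
      apply sqrt_le_iff.2
      refine ⟨by positivity, ?_⟩
      rw [hAc]
      nlinarith [mul_nonneg (sq_nonneg b) (sq_nonneg (cos t)), mul_nonneg c0 hb.le]
    have e : 1 / R - (cos t / (1 + sin t) + sin t / R)
        = - ((cos t / R) * (R - cos t) * (1 / (1 + sin t))) := by
      have : (1 + sin t) ≠ 0 := by positivity
      field_simp
      linear_combination -hsq
    rw [e, norm_neg, Real.norm_eq_abs]
    have h1 : cos t / R ≤ 1 := by rw [div_le_one hR]; exact hxR
    have h2 : 1 / (1 + sin t) ≤ 1 := by rw [div_le_one (by positivity)]; linarith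
    have h3 : 0 ≤ R - cos t := by linarith
    have h4 : 0 ≤ cos t / R := by positivity
    have h5 : 0 ≤ 1 / (1 + sin t) := by positivity
    rw [abs_of_nonneg (by positivity)]
    calc cos t / R * (R - cos t) * (1 / (1 + sin t)) ≤ 1 * b * 1 := by
          gcongr; linarith
      _ = b := by ring

open Real Set MeasureTheory in
theorem aux_J (k b : ℝ) (hk : 0 < k) (hb : 0 < b) (hb2 : 2 * b ≤ 1) (hkb : k^2 + b^2 = 1) :
    (π / 2) * log (1 / b) ≤ (∫ t in (0:ℝ)..(π/2),
      (log (1 / (2 * b)) - log (sin t)) * (1 / √(1 - b^2 * sin t ^ 2))) ∧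
    (∫ t in (0:ℝ)..(π/2),
      (log (1 / (2 * b)) - log (sin t)) * (1 / √(1 - b^2 * sin t ^ 2)))
      ≤ (π / 2) * log (1 / b) * (1 / k) := by
  have hpi : (0:ℝ) < π / 2 := by positivity
  have hA : ∀ t, 0 < 1 - b^2 * sin t ^ 2 := fun t => by
    nlinarith [sin_sq_add_cos_sq t, sq_nonneg (sin t), sq_nonneg (cos t), pow_pos hb 2, pow_pos hk 2]
  have hcont1 : Continuous (fun t => 1 / √(1 - b^2 * sin t ^ 2)) :=
    continuous_const.div (by fun_prop) (fun t => (sqrt_pos.2 (hA t)).ne')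
  have hlog : IntervalIntegrable (fun t => log (sin t)) volume 0 (π/2) := intervalIntegrable_log_sin
  have hg : IntervalIntegrable (fun t => log (1 / (2 * b)) - log (sin t)) volume 0 (π/2) :=
    intervalIntegrable_const.sub hlog
  have hgf := hg.mul_continuousOn hcont1.continuousOn
  have hJ : ∫ t in (0:ℝ)..(π/2), (log (1 / (2 * b)) - log (sin t)) = (π / 2) * log (1 / b) := by
    rw [intervalIntegral.integral_sub intervalIntegrable_const hlog, integral_log_sin_zero_pi_div_two,
      intervalIntegral.integral_const]
    have : 1 / (2 * b) = (1 / b) / 2 := by field_simp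
    rw [this, log_div (by positivity) two_ne_zero]
    simp only [smul_eq_mul]; ring
  have hnn : ∀ t, 0 ≤ log (1 / (2 * b)) - log (sin t) := fun t => by
    have h1 : 0 ≤ log (1 / (2 * b)) := log_nonneg (by rw [le_div_iff₀ (by positivity)]; linarith)
    have h2 : log (sin t) ≤ 0 := by
      rw [← log_abs]
      exact log_nonpos (abs_nonneg _) (abs_sin_le_one t)
    linarith
  have hs : ∀ t, sin t ^ 2 ≤ 1 := fun t => sin_sq_le_one t
  constructor
  · rw [← hJ]
    refine intervalIntegral.integral_mono_on hpi.le hg hgf ?_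
    intro t _
    have : 1 ≤ 1 / √(1 - b^2 * sin t ^ 2) := by
      rw [le_div_iff₀ (sqrt_pos.2 (hA t)), one_mul]
      apply sqrt_le_one.2
      nlinarith [mul_nonneg (sq_nonneg b) (sq_nonneg (sin t))]
    exact le_mul_of_one_le_right (hnn t) this
  · rw [← hJ, ← intervalIntegral.integral_mul_const]
    refine intervalIntegral.integral_mono_on hpi.le hgf (hg.mul_const _) ?_
    intro t _
    refine mul_le_mul_of_nonneg_left ?_ (hnn t)
    apply one_div_le_one_div_of_le hk
    apply le_sqrt_of_sq_le
    nlinarith [hs t, sq_nonneg b]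

set_option maxHeartbeats 1000000 in
theorem stmt9 (c : ℝ) (hc : 0 < c) :
    ∃ C > 0, ∃ η₀ > 0, ∀ η : ℝ, 0 < η → η < η₀ →
      |(1/Real.pi) * Delta c (c * (1 - η)) +
          (1/2) * (1 - 4 * Real.log 2 / Real.log (1/η))|
        ≤ C / (Real.log (1/η))^2 := by

  have hl2a := Real.log_two_gt_d9
  have hl2b := Real.log_two_lt_d9
  have hpa := Real.pi_gt_three
  have hpb := Real.pi_lt_d2
  refine ⟨50, by norm_num, 1/100, by norm_num, ?_⟩
  intro η h0 h1
  set L := Real.log (1/η) with hL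
  set l := Real.log 2 with hl
  set r := Real.sqrt η with hr
  have hr0 : 0 < r := Real.sqrt_pos.2 h0
  have hr2 : r^2 = η := Real.sq_sqrt h0.le
  have hr1 : r < 1/10 := by
    rw [hr, Real.sqrt_lt' (by norm_num)]; norm_num; linarith
  have hLr : L * r ≤ 2 := by
    have e : L = 2 * Real.log (1/r) := by
      rw [hL, ← hr2, one_div, one_div, Real.log_inv, Real.log_inv, Real.log_pow]; push_cast; ring
    have := Real.log_le_sub_one_of_pos (show 0 < 1/r by positivity)
    have h3 : L ≤ 2 * (1 / r) := by linarith
    calc L * r ≤ 2 * (1/r) * r := by gcongr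
      _ = 2 := by field_simp
  have hL4 : 4 ≤ L := by
    have : Real.log 64 ≤ L := Real.log_le_log (by norm_num) (by
      rw [le_div_iff₀ h0]; linarith)
    have e : Real.log 64 = 6 * l := by
      rw [show (64:ℝ) = 2^6 by norm_num, Real.log_pow]; push_cast; ring
    linarith
  set k := 1 - η with hk
  set b := Real.sqrt (η * (2 - η)) with hb
  have hb2 : b^2 = η * (2 - η) := Real.sq_sqrt (by nlinarith)
  have hb0 : 0 < b := Real.sqrt_pos.2 (by nlinarith)
  have hk0 : 0 < k := by linarith
  have hkb : k^2 + b^2 = 1 := by rw [hb2, hk]; ring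
  have hbr : b ≤ 1.5 * r := by
    refine (abs_le_of_sq_le_sq' ?_ (by positivity)).2
    nlinarith
  have hlogb : Real.log (1/b) = (L - Real.log (2 - η)) / 2 := by
    rw [hb, one_div, Real.log_inv, Real.log_sqrt (by nlinarith), Real.log_mul h0.ne' (by linarith),
      hL, one_div, Real.log_inv]; ring
  set m := Real.log (2 - η) with hm
  have hm1 : m ≤ l := Real.log_le_log (by linarith) (by linarith)
  have hm2 : l - η ≤ m := by
    have := Real.log_le_sub_one_of_pos (show 0 < 2 / (2 - η) by
      apply div_pos two_pos; linarith)
    rw [Real.log_div two_ne_zero (by linarith)] at this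
    have h3 : 2 / (2 - η) - 1 ≤ η := by
      rw [sub_le_iff_le_add, div_le_iff₀ (by linarith)]; nlinarith
    linarith
  have hik1 : 1 / k ≤ 1 + 2 * η := by
    rw [div_le_iff₀ hk0, hk]; nlinarith
  have hik0 : 1 ≤ 1 / k := by rw [le_div_iff₀ hk0]; linarith
  have hK := aux_K k b hk0 hb0 hkb
  rw [← aux_I1_eq c k hc hk0 (by linarith)] at hK
  have hJ := aux_J k b hk0 hb0 (by linarith) hkb
  rw [← aux_I2_eq c k b hc hk0 hb0 hkb, hlogb] at hJ
  have hlk : Real.log ((1 + k) / b) = (L + m) / 2 := by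
    have : (1 + k) / b = (2 - η) * (1 / b) := by rw [hk]; ring
    rw [this, Real.log_mul (by linarith) (by positivity), hlogb]; ring
  rw [hlk] at hK
  have hDelta : Delta c (c * k) = -(c * I2 c (c * k)) / (c * I1 c (c * k)) := by
    rw [Delta, ← mul_neg, mul_div_mul_left _ _ hc.ne']
  rw [hDelta]
  set P := c * I1 c (c * k) with hP
  set Q := c * I2 c (c * k) with hQ
  have hη : η ≤ 0.1 * r := by nlinarith
  have hηL : η * L ≤ 2 * r := by rw [← hr2]; nlinarith
  -- estimate of p
  have hε1 : |2 * P - (L + 3 * l)| ≤ 10 * r := by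
    rw [abs_le] at hK ⊢
    have hbp : b * (Real.pi / 2) ≤ 1.5 * r * 1.575 := by
      apply mul_le_mul hbr (by linarith) (by positivity) (by positivity)
    have hLm : 0 ≤ (L + m) / 2 := by linarith
    have u1 : 1 / k * ((L + m)/2) ≤ (1 + 2 * η) * ((L + m)/2) := by gcongr
    have u2 : (L + m)/2 ≤ 1 / k * ((L + m)/2) := le_mul_of_one_le_left hLm hik0
    have u3 : η * m ≤ η := by nlinarith
    have u4 : (1 + 2 * η) * ((L + m)/2) = (L + m) / 2 + η * L + η * m := by ring
    rw [u4] at u1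
    obtain ⟨hK1, hK2⟩ := hK
    clear_value L l r m b k P Q
    constructor <;> linarith
  have hε2 : |4 * Q / Real.pi - (L - l)| ≤ 5 * r := by
    have hLm : 0 ≤ (L - m) / 2 := by linarith
    have e1 : L - m ≤ 4 * Q / Real.pi := by
      rw [le_div_iff₀ (by linarith)]; linarith [hJ.1]
    have e2 : 4 * Q / Real.pi ≤ (L - m) * (1 + 2 * η) := by
      rw [div_le_iff₀ (by linarith)]
      have : Real.pi / 2 * ((L - m) / 2) * (1 / k) ≤ Real.pi / 2 * ((L - m) / 2) * (1 + 2 * η) := by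
        gcongr
      linarith [hJ.2]
    rw [abs_le]
    have u3 : 0 ≤ η * m := mul_nonneg h0.le (by linarith)
    have u4 : (L - m) * (1 + 2 * η) = L - m + 2 * (η * L) - 2 * (η * m) := by ring
    rw [u4] at e2
    constructor <;> linarith
  set p := 2 * P with hp
  set q := 4 * Q / Real.pi with hq
  have hpL : L ≤ p := by
    have := (abs_le.1 hε1).1
    linarith
  have hL0 : 0 < L := by linarith
  have hp0 : 0 < p := by linarith
  have hexp : (1 / Real.pi) * (-Q / P) + (1/2) * (1 - 4 * l / L)
      = (1/2) * (((L - 4 * l) * (p - (L + 3 * l)) - L * (q - (L - l)) - 12 * l^2) / (L * p)) := by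
    have hP0 : P ≠ 0 := by linarith
    have hpi0 : Real.pi ≠ 0 := by positivity
    rw [hp, hq]
    field_simp
    ring
  rw [hexp]
  have hnum : |(L - 4 * l) * (p - (L + 3 * l)) - L * (q - (L - l)) - 12 * l^2| ≤ 100 := by
    have v1 : |(L - 4 * l) * (p - (L + 3 * l))| ≤ 20 := by
      rw [abs_mul, abs_of_nonneg (by linarith)]
      calc (L - 4 * l) * |p - (L + 3 * l)| ≤ L * (10 * r) := by gcongr; linarith
        _ ≤ 20 := by linarith
    have v2 : |L * (q - (L - l))| ≤ 10 := by
      rw [abs_mul, abs_of_pos hL0]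
      calc L * |q - (L - l)| ≤ L * (5 * r) := by gcongr
        _ ≤ 10 := by linarith
    rw [abs_le] at v1 v2 ⊢
    have v3 : l^2 ≤ 1 := by nlinarith
    constructor <;> nlinarith [sq_nonneg l]
  rw [abs_mul, abs_of_pos (show (0:ℝ) < 1/2 by norm_num), abs_div, abs_of_pos (show 0 < L * p by positivity)]
  calc _ ≤ (1/2) * (100 / (L * L)) := by gcongr
    _ = 50 / L^2 := by ring
end

section
/- Let c>0, let f:[−c²/2,c²/3]→[0,c] be the increasing homeomorphism determined by the modulation equations, set η(d)=1−d/c and v(ξ)=1−3ξ/c². If d=f(ξ), η=η(d) and v=v(ξ), then as v→0⁺ one has η = (v/log(1/v))·(1 − (log(8e) + log log(1/v))/log(1/v)) + O(v·log²(log(1/v))/log³(1/v)); that is, there exist constants C>0 and v₀>0 such that for 0<v<v₀, |η − (v/log(1/v))·(1 − (log(8e)+log log(1/v))/log(1/v))| ≤ C·v·(log log(1/v))²/(log(1/v))³. -/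
/-- `μ²(d) = (∫₀^d y²·√((d²−y²)/(c²−y²)) dy)/(∫₀^d √((d²−y²)/(c²−y²)) dy)`. -/
noncomputable def mu2 (c d : ℝ) : ℝ :=
  (∫ y in (0:ℝ)..d, y^2 * Real.sqrt ((d^2 - y^2) / (c^2 - y^2))) /
    (∫ y in (0:ℝ)..d, Real.sqrt ((d^2 - y^2) / (c^2 - y^2)))

/-- weight -/
noncomputable def wgt (k y : ℝ) : ℝ := Real.sqrt ((k^2 - y^2) / (1 - y^2))

lemma wgt_cont {k : ℝ} (h0 : 0 ≤ k) (h1 : k < 1) : ContinuousOn (wgt k) (Set.Icc 0 k) := by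
  unfold wgt
  apply ContinuousOn.sqrt
  apply ContinuousOn.div (by fun_prop) (by fun_prop)
  intro y hy
  have := hy.1; have := hy.2
  nlinarith

lemma pq_facts {k y : ℝ} (h1 : k < 1) (hy : y ∈ Set.Ioo 0 k) :
    0 < √(k^2 - y^2) ∧ 0 < √(1 - y^2) ∧ √(k^2 - y^2)^2 = k^2 - y^2 ∧ √(1 - y^2)^2 = 1 - y^2 ∧
    wgt k y = √(k^2 - y^2) / √(1 - y^2) ∧ 0 < k^2 - y^2 ∧ 0 < 1 - y^2 := by
  obtain ⟨a, b⟩ := hy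
  have hp : 0 < k^2 - y^2 := by nlinarith
  have hq : 0 < 1 - y^2 := by nlinarith
  refine ⟨Real.sqrt_pos.2 hp, Real.sqrt_pos.2 hq, Real.sq_sqrt hp.le, Real.sq_sqrt hq.le, ?_, hp, hq⟩
  unfold wgt
  rw [Real.sqrt_div hp.le]

lemma hasDeriv_P {k y : ℝ} (h : 0 < k^2 - y^2) :
    HasDerivAt (fun y => √(k^2 - y^2)) (-y / √(k^2 - y^2)) y := by
  have h2 : HasDerivAt (fun y : ℝ => k^2 - y^2) (-(2*y)) y := by
    simpa using (hasDerivAt_pow 2 y).const_sub (k^2)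
  convert h2.sqrt h.ne' using 1
  have := Real.sqrt_pos.2 h
  field_simp

lemma hasDeriv_G {k y : ℝ} (h1 : k < 1) (hy : y ∈ Set.Ioo 0 k) :
    HasDerivAt (fun y => y * √(1 - y^2) * √(k^2 - y^2) / 3)
      ((1/3 - y^2) * wgt k y - (1 - k^2)/3 * (y^2 / (√(1 - y^2) * √(k^2 - y^2)))) y := by
  obtain ⟨hP, hQ, hP2, hQ2, hw, hp, hq⟩ := pq_facts h1 hy
  have e1 : HasDerivAt (fun y => √(1 - y^2)) (-y / √(1 - y^2)) y := by
    have := @hasDeriv_P 1 y (by simpa using hq)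
    simpa using this
  have e2 := hasDeriv_P hp
  refine HasDerivAt.congr_deriv ((((hasDerivAt_id' y).fun_mul e1).fun_mul e2).div_const 3) ?_
  rw [hw]
  set P := √(k^2 - y^2)
  set Q := √(1 - y^2)
  have hk : k^2 = P^2 + y^2 := by linarith
  have hy2 : y^2 = 1 - Q^2 := by linarith
  field_simp
  rw [hk]
  have : Q^2 = 1 - y^2 := hQ2
  ring_nf
  simp only [this]
  ring

/-- D -/
noncomputable def Dint (k : ℝ) : ℝ := ∫ y in (0:ℝ)..k, (1/3 - y^2) * wgt k y
/-- A -/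
noncomputable def Aint (k : ℝ) : ℝ := ∫ y in (0:ℝ)..k, wgt k y

lemma phi_int {k : ℝ} (h0 : 0 ≤ k) (h1 : k < 1) :
    MeasureTheory.IntegrableOn (fun y => (1/3 - y^2) * wgt k y) (Set.Icc 0 k) :=
  (ContinuousOn.mul (by fun_prop) (wgt_cont h0 h1)).integrableOn_Icc

lemma D_nonneg {k : ℝ} (h0 : 0 ≤ k) (h1 : k < 1) : 0 ≤ Dint k := by
  have := intervalIntegral.sub_le_integral_of_hasDeriv_right_of_le (a := 0) (b := k)
    (g := fun y => y * √(1 - y^2) * √(k^2 - y^2) / 3)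
    (g' := fun y => (1/3 - y^2) * wgt k y - (1 - k^2)/3 * (y^2 / (√(1 - y^2) * √(k^2 - y^2))))
    (φ := fun y => (1/3 - y^2) * wgt k y) h0 (by fun_prop)
    (fun y hy => (hasDeriv_G h1 hy).hasDerivWithinAt) (phi_int h0 h1) (by
      intro y hy
      have : 0 ≤ (1 - k^2)/3 := by nlinarith
      have : 0 ≤ (1 - k^2)/3 * (y^2 / (√(1 - y^2) * √(k^2 - y^2))) := by positivity
      linarith)
  simpa [Dint] using this

lemma hasDeriv_F {k y : ℝ} (h1 : k < 1) (hy : y ∈ Set.Ioo 0 k) (t : ℝ) :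
    HasDerivAt (fun y => y * √(1 - y^2) * √(k^2 - y^2) / 3 + (1 - k^2)/3 *
        (-Real.log (√(1 - y^2) + √(k^2 - y^2)) - (y - Real.log (1 + y)) + t * √(k^2 - y^2)))
      ((1/3 - y^2) * wgt k y - (1 - k^2)/3 * (y^2 / (√(1 - y^2) * √(k^2 - y^2))) + (1 - k^2)/3 *
        (y / (√(1 - y^2) * √(k^2 - y^2)) - y / (1 + y) + t * (-y / √(k^2 - y^2)))) y := by
  refine (hasDeriv_G h1 hy).add (HasDerivAt.const_mul _ ?_)
  obtain ⟨hP, hQ, hP2, hQ2, hw, hp, hq⟩ := pq_facts h1 hy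
  have e1 : HasDerivAt (fun y => √(1 - y^2)) (-y / √(1 - y^2)) y := by
    have := @hasDeriv_P 1 y (by simpa using hq)
    simpa using this
  have e2 := hasDeriv_P hp
  have hy0 := hy.1
  refine ((?_ : HasDerivAt _ _ _).sub ?_).add (e2.const_mul t)
  · have := ((e1.fun_add e2).log (by positivity)).fun_neg
    refine this.congr_deriv ?_
    field_simp
    ring
  · have := (hasDerivAt_id' y).fun_sub (((hasDerivAt_id' y).const_add 1).log (by positivity))
    refine this.congr_deriv ?_
    field_simp
    ring

lemma contF {k : ℝ} (h0 : 0 < k) (h1 : k < 1) (t : ℝ) :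
    ContinuousOn (fun y => y * √(1 - y^2) * √(k^2 - y^2) / 3 + (1 - k^2)/3 *
        (-Real.log (√(1 - y^2) + √(k^2 - y^2)) - (y - Real.log (1 + y)) + t * √(k^2 - y^2)))
      (Set.Icc 0 k) := by
  have a : ContinuousOn (fun y => Real.log (√(1 - y^2) + √(k^2 - y^2))) (Set.Icc 0 k) := by
    apply ContinuousOn.log (by fun_prop)
    intro y hy
    have := hy.1; have := hy.2
    have : 0 < √(1 - y^2) := Real.sqrt_pos.2 (by nlinarith)
    positivity
  have b : ContinuousOn (fun y : ℝ => Real.log (1 + y)) (Set.Icc 0 k) := by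
    apply ContinuousOn.log (by fun_prop)
    intro y hy
    have := hy.1
    positivity
  fun_prop

/-- T -/
noncomputable def Tval (k : ℝ) : ℝ := 3/2 * Real.log (1 + k) - Real.log (1 - k) / 2 - k

lemma F_end {k : ℝ} (h0 : 0 < k) (h1 : k < 1) (t : ℝ) :
    (k * √(1 - k^2) * √(k^2 - k^2) / 3 + (1 - k^2)/3 *
        (-Real.log (√(1 - k^2) + √(k^2 - k^2)) - (k - Real.log (1 + k)) + t * √(k^2 - k^2)))
    - (0 * √(1 - 0^2) * √(k^2 - 0^2) / 3 + (1 - k^2)/3 *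
        (-Real.log (√(1 - 0^2) + √(k^2 - 0^2)) - (0 - Real.log (1 + 0)) + t * √(k^2 - 0^2)))
    = (1 - k^2)/3 * (Tval k - t * k) := by
  have e : Real.log √(1 - k^2) = (Real.log (1 + k) + Real.log (1 - k)) / 2 := by
    rw [Real.log_sqrt (by nlinarith), ← Real.log_mul (by linarith) (by linarith)]
    congr 2; ring
  simp [Real.sqrt_sq h0.le, e, Tval]
  ring

lemma D_lower {k : ℝ} (h0 : 0 < k) (h1 : k < 1) :
    (1 - k^2)/3 * (Tval k - √(1 - k^2)) ≤ Dint k := by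
  have := intervalIntegral.sub_le_integral_of_hasDeriv_right_of_le (a := 0) (b := k)
    (φ := fun y => (1/3 - y^2) * wgt k y) h0.le (contF h0 h1 (√(1 - k^2)))
    (fun y hy => (hasDeriv_F h1 hy _).hasDerivWithinAt) (phi_int h0.le h1) (by
      intro y hy
      obtain ⟨hP, hQ, hP2, hQ2, hw, hp, hq⟩ := pq_facts h1 hy
      have hy0 := hy.1
      have hs : 0 < 1 - k^2 := by nlinarith
      have hS := Real.sqrt_pos.2 hs
      have hS2 := Real.sq_sqrt hs.le
      set P := √(k^2 - y^2)
      set Q := √(1 - y^2)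
      set S := √(1 - k^2)
      have key : y / (Q * P) - y / (1 + y) + S * (-y / P) ≤ y^2 / (Q * P) := by
        have hQle : Q ≤ P + S * (1 + y) := by
          nlinarith [mul_pos hS hy0, mul_pos hS hP, mul_pos hP (mul_pos hS hy0)]
        have : y^2 / (Q * P) - (y / (Q * P) - y / (1 + y) + S * (-y / P))
          = y * (P + S * (1 + y) - Q) / (P * (1 + y)) := by
          have : Q^2 = (1 - y) * (1 + y) := by linarith
          rw [show y / (Q * P) = y * Q / (Q^2 * P) by field_simp,
            show y^2 / (Q * P) = y^2 * Q / (Q^2 * P) by field_simp, this]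
          have h1y : 1 - y ≠ 0 := by
            have := hy.2
            intro h; linarith
          field_simp
          ring
        have h2 : 0 ≤ y * (P + S * (1 + y) - Q) / (P * (1 + y)) := by
          apply div_nonneg (mul_nonneg hy0.le (by linarith)) (by positivity)
        linarith
      have := mul_le_mul_of_nonneg_left key (by linarith : 0 ≤ (1 - k^2)/3)
      linarith)
  rw [F_end h0 h1] at this
  refine le_trans ?_ this
  have hs : 0 < 1 - k^2 := by nlinarith
  have hS := Real.sqrt_pos.2 hs
  apply mul_le_mul_of_nonneg_left _ (by linarith)
  nlinarith

lemma D_upper {k : ℝ} (h0 : 0 < k) (h1 : k < 1) :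
    Dint k ≤ (1 - k^2)/3 * Tval k := by
  have := intervalIntegral.integral_le_sub_of_hasDeriv_right_of_le (a := 0) (b := k)
    (φ := fun y => (1/3 - y^2) * wgt k y) h0.le (contF h0 h1 0)
    (fun y hy => (hasDeriv_F h1 hy _).hasDerivWithinAt) (phi_int h0.le h1) (by
      intro y hy
      obtain ⟨hP, hQ, hP2, hQ2, hw, hp, hq⟩ := pq_facts h1 hy
      have hy0 := hy.1
      have hs : 0 < 1 - k^2 := by nlinarith
      set P := √(k^2 - y^2)
      set Q := √(1 - y^2)
      have key : y^2 / (Q * P) ≤ y / (Q * P) - y / (1 + y) + 0 * (-y / P) := by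
        have hQle : P ≤ Q := Real.sqrt_le_sqrt (by linarith)
        have : y / (Q * P) - y / (1 + y) + 0 * (-y / P) - y^2 / (Q * P)
          = y * (Q - P) / (P * (1 + y)) := by
          have : Q^2 = (1 - y) * (1 + y) := by linarith
          rw [show y / (Q * P) = y * Q / (Q^2 * P) by field_simp,
            show y^2 / (Q * P) = y^2 * Q / (Q^2 * P) by field_simp, this]
          have h1y : 1 - y ≠ 0 := by
            have := hy.2
            intro h; linarith
          field_simp
          ring
        have h2 : 0 ≤ y * (Q - P) / (P * (1 + y)) := by
          apply div_nonneg (mul_nonneg hy0.le (by linarith)) (by positivity)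
        linarith
      have := mul_le_mul_of_nonneg_left key (by linarith : 0 ≤ (1 - k^2)/3)
      linarith)
  rw [F_end h0 h1] at this
  rw [zero_mul, sub_zero] at this
  exact this

lemma wgt_int {k : ℝ} (h0 : 0 ≤ k) (h1 : k < 1) :
    IntervalIntegrable (wgt k) MeasureTheory.volume 0 k :=
  ContinuousOn.intervalIntegrable (by rw [Set.uIcc_of_le h0]; exact wgt_cont h0 h1)

lemma A_nonneg {k : ℝ} (h0 : 0 ≤ k) : 0 ≤ Aint k :=
  intervalIntegral.integral_nonneg h0 (fun _ _ => Real.sqrt_nonneg _)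

lemma A_le {k : ℝ} (h0 : 0 ≤ k) (h1 : k < 1) : Aint k ≤ 1 := by
  have := intervalIntegral.integral_mono_on h0 (wgt_int h0 h1)
    (intervalIntegrable_const (c := (1:ℝ))) (by
      intro y hy
      have := hy.1; have := hy.2
      unfold wgt
      rw [Real.sqrt_le_one, div_le_one (by nlinarith)]
      nlinarith)
  simp at this
  unfold Aint
  linarith

lemma A_lower {k : ℝ} (h0 : 0 ≤ k) (h1 : k < 1) : k - 2 * √(1 - k^2) ≤ Aint k := by
  have := intervalIntegral.sub_le_integral_of_hasDeriv_right_of_le (a := 0) (b := k)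
    (g := fun y => y + 2 * √(1 - k^2) * √(1 - y))
    (g' := fun y => 1 + 2 * √(1 - k^2) * (-1 / (2 * √(1 - y))))
    (φ := wgt k) h0 (by fun_prop)
    (fun y hy => (by
      have := hy.2
      have h := ((hasDerivAt_id y).const_sub 1).sqrt (by simp; linarith)
      exact ((hasDerivAt_id y).add (h.const_mul _)).hasDerivWithinAt))
    (wgt_cont h0 h1).integrableOn_Icc (by
      intro y hy
      obtain ⟨hP, hQ, hP2, hQ2, hw, hp, hq⟩ := pq_facts h1 hy
      have hy0 := hy.1
      have hs : 0 < 1 - k^2 := by nlinarith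
      have hS := Real.sqrt_pos.2 hs
      have hS2 := Real.sq_sqrt hs.le
      have hy1 : 0 < 1 - y := by linarith [hy.2]
      have hR := Real.sqrt_pos.2 hy1
      have hRQ : √(1 - y) ≤ √(1 - y^2) := Real.sqrt_le_sqrt (by nlinarith)
      rw [hw]
      set P := √(k^2 - y^2)
      set Q := √(1 - y^2)
      set S := √(1 - k^2)
      set R := √(1 - y)
      have h3 : S / Q ≤ S / R := div_le_div_of_nonneg_left hS.le hR hRQ
      have h4 : (Q - S) / Q ≤ P / Q := by
        apply div_le_div_of_nonneg_right _ hQ.le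
        nlinarith
      have h5 : (Q - S) / Q = 1 - S / Q := by field_simp
      have h6 : 1 + 2 * S * (-1 / (2 * R)) = 1 - S / R := by field_simp; ring
      linarith)
  unfold Aint
  refine le_trans ?_ this
  have := mul_nonneg (Real.sqrt_nonneg (1 - k^2)) (Real.sqrt_nonneg (1 - k))
  simp
  linarith

lemma mu2_eq {c k : ℝ} (hc : 0 < c) (h0 : 0 ≤ k) (h1 : k < 1) (hA : Aint k ≠ 0) :
    mu2 c (c * k) = c^2 * (1/3 - Dint k / Aint k) := by
  have e : ∀ y, Real.sqrt (((c*k)^2 - (c*y)^2) / (c^2 - (c*y)^2)) = wgt k y := by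
    intro y
    unfold wgt
    congr 1
    rw [show (c*k)^2 - (c*y)^2 = c^2 * (k^2 - y^2) by ring,
      show c^2 - (c*y)^2 = c^2 * (1 - y^2) by ring, mul_div_mul_left _ _ (by positivity)]
  have i1 : (∫ y in (0:ℝ)..(c*k), Real.sqrt (((c*k)^2 - y^2) / (c^2 - y^2))) = c * Aint k := by
    have := intervalIntegral.mul_integral_comp_mul_left (a := 0) (b := k)
      (f := fun y => Real.sqrt (((c*k)^2 - y^2) / (c^2 - y^2))) c
    simp only [e, mul_zero] at this
    exact this.symm
  have i2 : (∫ y in (0:ℝ)..(c*k), y^2 * Real.sqrt (((c*k)^2 - y^2) / (c^2 - y^2)))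
      = c^3 * (Aint k / 3 - Dint k) := by
    have := intervalIntegral.mul_integral_comp_mul_left (a := 0) (b := k)
      (f := fun y => y^2 * Real.sqrt (((c*k)^2 - y^2) / (c^2 - y^2))) c
    simp only [e, mul_zero] at this
    rw [← this]
    have h2 : ∀ y, (c*y)^2 * wgt k y = c^2 * (1/3 * wgt k y - (1/3 - y^2) * wgt k y) := by
      intro y; ring
    simp only [h2]
    rw [intervalIntegral.integral_const_mul, intervalIntegral.integral_sub
      ((wgt_int h0 h1).const_mul _), intervalIntegral.integral_const_mul]
    · unfold Aint Dint; ring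
    · exact (ContinuousOn.mul (by fun_prop)
        (by rw [Set.uIcc_of_le h0]; exact wgt_cont h0 h1)).intervalIntegrable
  unfold mu2
  rw [i1, i2]
  field_simp

lemma b_bounds : 1 ≤ Real.log (8 * Real.exp 1) ∧ Real.log (8 * Real.exp 1) ≤ 4 ∧
    Real.log (8 * Real.exp 1) = 3 * Real.log 2 + 1 := by
  have e : Real.log (8 * Real.exp 1) = 3 * Real.log 2 + 1 := by
    rw [Real.log_mul (by norm_num) (Real.exp_pos 1).ne', Real.log_exp,
      show (8:ℝ) = 2^3 by norm_num, Real.log_pow]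
    norm_num
  have := Real.log_two_lt_d9
  have := Real.log_two_gt_d9
  refine ⟨by linarith, by linarith, e⟩

lemma final_step {v η K : ℝ} (hv : 0 < v) (hη : 0 < η) (hηv : η ≤ v) (hK : 0 ≤ K)
    (hl : 1000 ≤ Real.log (1/v)) (hKl : K ≤ Real.log (1/v))
    (h : |v/η - Real.log (8 * Real.exp 1 / η)| * Real.log (8 * Real.exp 1 / η) ≤ K) :
    |η - (v / Real.log (1/v)) *
            (1 - (Real.log (8 * Real.exp 1) + Real.log (Real.log (1/v))) /
              Real.log (1/v))|
        ≤ (72 + K) * v * (Real.log (Real.log (1/v)))^2 / (Real.log (1/v))^3 := by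
  obtain ⟨b1, b4, -⟩ := b_bounds
  have hM : Real.log (8 * Real.exp 1 / η) =
      Real.log (8 * Real.exp 1) + Real.log (1/v) + Real.log (v/η) := by
    rw [← Real.log_mul (by positivity) (by positivity), ← Real.log_mul (by positivity) (by positivity)]
    congr 1
    field_simp
  rw [hM] at h
  have hX1 : 1 ≤ v / η := (one_le_div hη).2 hηv
  have hηX : η = v / (v/η) := by field_simp
  set X := v / η with hX
  rw [hηX]
  clear_value X
  set l := Real.log (1/v)
  set b := Real.log (8 * Real.exp 1)
  have hlX := Real.log_nonneg hX1
  have hl0 : 0 < l := by linarith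
  have hX0 : 0 < X := by linarith
  obtain ⟨ε, hε⟩ : ∃ ε, ε = X - (b + l + Real.log X) := ⟨_, rfl⟩
  rw [← hε] at h
  have hε1 : |ε| * l ≤ K := le_trans (mul_le_mul_of_nonneg_left (by linarith) (abs_nonneg _)) h
  have hε2 : |ε| ≤ K / l := by rwa [le_div_iff₀ hl0]
  have hε3 : |ε| ≤ 1 := hε2.trans ((div_le_one hl0).2 hKl)
  have hε4 := abs_le.1 hε3
  have hXl : l ≤ X := by linarith
  have hX3 : X ≤ 3 * l := by
    have h1 := Real.log_le_sub_one_of_pos (by positivity : 0 < X/2)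
    rw [Real.log_div hX0.ne' (by norm_num)] at h1
    have := Real.log_two_lt_d9
    linarith
  set lam := Real.log l with hlam
  have hlam1 : 1 ≤ lam := by
    rw [hlam, Real.le_log_iff_exp_le hl0]
    have := Real.exp_one_lt_d9
    linarith
  obtain ⟨θ, hθ⟩ : ∃ θ, θ = Real.log (X / l) := ⟨_, rfl⟩
  have hθX : Real.log X = lam + θ := by
    rw [hθ, Real.log_div hX0.ne' hl0.ne']; ring
  have hθ0 : 0 ≤ θ := by rw [hθ]; exact Real.log_nonneg ((one_le_div hl0).2 hXl)
  have hθ1 : θ ≤ X / l - 1 := by rw [hθ]; exact Real.log_le_sub_one_of_pos (by positivity)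
  have hθ2 : θ ≤ 2 := by
    have : X / l ≤ 3 := (div_le_iff₀ hl0).2 hX3
    linarith
  obtain ⟨p, hp⟩ : ∃ p, p = X - l := ⟨_, rfl⟩
  have hp8 : p ≤ 8 * lam := by linarith
  have hp0 : 0 ≤ p := by linarith
  have hθ3 : θ ≤ 8 * lam / l := by
    refine hθ1.trans ?_
    rw [show X / l - 1 = p / l by rw [hp]; field_simp]
    exact div_le_div_of_nonneg_right hp8 hl0.le
  have hδ : |θ + ε| ≤ (8 + K) * lam ^ 2 / l := by
    refine (abs_add_le _ _).trans ?_
    rw [abs_of_nonneg hθ0]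
    have : 8 * lam / l + K / l ≤ (8 + K) * lam ^ 2 / l := by
      rw [← add_div]
      apply div_le_div_of_nonneg_right _ hl0.le
      nlinarith [mul_nonneg hK (by nlinarith : 0 ≤ lam^2 - 1)]
    linarith
  have hpX : p^2 / X ≤ 64 * lam^2 / l := by
    apply div_le_div₀ (by positivity) _ hl0 hXl
    nlinarith
  have hpX0 : 0 ≤ p^2 / X := by positivity
  have key : v / X - v / l * (1 - (b + lam) / l) = v / l^2 * (p^2 / X - (θ + ε)) := by
    have : θ + ε = X - l - b - lam := by rw [hε, hθX]; ring
    rw [this, hp]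
    field_simp
    ring
  rw [key, abs_mul, abs_of_nonneg (by positivity : 0 ≤ v / l^2)]
  have : |p^2 / X - (θ + ε)| ≤ (72 + K) * lam^2 / l := by
    have h1 := abs_sub (p^2 / X) (θ + ε)
    rw [abs_of_nonneg hpX0] at h1
    have : (72 + K) * lam^2 / l = 64 * lam^2 / l + (8 + K) * lam ^ 2 / l := by ring
    linarith
  calc _ ≤ v / l^2 * ((72 + K) * lam^2 / l) := mul_le_mul_of_nonneg_left this (by positivity)
    _ = _ := by field_simp

set_option maxHeartbeats 1000000 in
lemma XM_bound {v η : ℝ} (hη : 0 < η) (hs : η ≤ 1/100)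
    (hA : 0 < Aint (1 - η))
    (h : v = 3 * (Dint (1 - η) / Aint (1 - η)) + 3/2 * (1 - (1 - η)^2)) :
    |v/η - Real.log (8 * Real.exp 1 / η)| * Real.log (8 * Real.exp 1 / η) ≤ 896 := by
  obtain ⟨k, hk⟩ : ∃ k, k = 1 - η := ⟨_, rfl⟩
  rw [← hk] at h hA
  have h0 : 0 < k := by linarith
  have h1 : k < 1 := by linarith
  have hσ : 1 - k^2 = η * (2 - η) := by rw [hk]; ring
  have hσ0 : 0 < 1 - k^2 := by nlinarith
  have D0 := D_nonneg h0.le h1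
  have DL := D_lower h0 h1
  have DU := D_upper h0 h1
  have A1 := A_le h0.le h1
  have AL := A_lower h0.le h1
  have ha0 := Real.sqrt_pos.2 hσ0
  have ha2 := Real.sq_sqrt hσ0.le
  have hasq : √(1 - k^2) ≤ √(2 * η) := Real.sqrt_le_sqrt (by nlinarith)
  set a := √(1 - k^2)
  have ha6 : a ≤ 1/6 := by nlinarith
  have hηa : η ≤ a := by nlinarith
  obtain ⟨U, hU⟩ : ∃ U, U = 3 * Dint k / (1 - k^2) := ⟨_, rfl⟩
  have hDU : Dint k = (1 - k^2)/3 * U := by rw [hU]; field_simp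
  rw [hDU] at D0 DL DU h
  have hσ3 : 0 < (1 - k^2)/3 := by linarith
  have U0 : 0 ≤ U := nonneg_of_mul_nonneg_right D0 hσ3
  have UL := le_of_mul_le_mul_left DL hσ3
  have UU := le_of_mul_le_mul_left DU hσ3
  set T := Tval k with hT
  obtain ⟨q, hq⟩ : ∃ q, q = U / Aint k := ⟨_, rfl⟩
  have hUq : U = q * Aint k := by rw [hq]; field_simp
  have hX : v / η = (2 - η) * (q + 3/2) := by
    rw [h, hq, hσ]; field_simp
  have q0 : 0 ≤ q := by rw [hq]; positivity
  have qL : T - a ≤ q := by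
    have : q * Aint k ≤ q * 1 := mul_le_mul_of_nonneg_left A1 q0
    linarith
  have T0 : 0 ≤ T := by linarith
  have qU : q ≤ T * (1 + 6 * a) := by
    have e1 : q * (1 - 3 * a) ≤ T := by
      have : q * (1 - 3 * a) ≤ q * Aint k := mul_le_mul_of_nonneg_left (by linarith) q0
      linarith
    have e2 : q * (1 - 3*a) * (1 + 6 * a) ≤ T * (1 + 6 * a) :=
      mul_le_mul_of_nonneg_right e1 (by linarith)
    have e3 : 1 ≤ (1 - 3*a) * (1 + 6 * a) := by
      have : a * a ≤ a * (1/6) := mul_le_mul_of_nonneg_left ha6 ha0.le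
      linarith
    have e4 := mul_le_mul_of_nonneg_left e3 q0
    linarith
  obtain ⟨-, -, hb⟩ := b_bounds
  have hM : Real.log (8 * Real.exp 1 / η) = 3 * Real.log 2 + 1 - Real.log η := by
    rw [Real.log_div (by positivity) hη.ne', hb]
  have hM2 : Real.log (8 * Real.exp 1 / η) ^ 2 * √(2 * η) ≤ 112 := by
    set z := 8 * Real.exp 1 / η with hz
    have hz0 : 0 < z := by positivity
    have e1 : Real.log z = 4 * Real.log (√(√z)) := by
      rw [Real.log_sqrt (Real.sqrt_nonneg _), Real.log_sqrt hz0.le]; ring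
    have hzz : 1 ≤ √(√z) := by
      rw [Real.one_le_sqrt, Real.one_le_sqrt, hz, one_le_div hη]
      have := Real.exp_one_gt_d9
      linarith
    have e2 : Real.log (√(√z)) ≤ √(√z) := Real.log_le_self (by linarith)
    have e3 := Real.log_nonneg hzz
    have e4 : Real.log z ^ 2 ≤ 16 * √z := by
      have : √(√z)^2 = √z := Real.sq_sqrt (Real.sqrt_nonneg _)
      rw [e1]; nlinarith
    have e5 : √z * √(2 * η) ≤ 7 := by
      rw [← Real.sqrt_mul hz0.le, hz, Real.sqrt_le_left (by norm_num)]
      have := Real.exp_one_lt_d9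
      rw [show 8 * Real.exp 1 / η * (2 * η) = 16 * Real.exp 1 by field_simp; ring]
      linarith
    nlinarith [Real.sqrt_nonneg (2 * η)]
  rw [hM] at hM2 ⊢
  have hlη : Real.log η ≤ 0 := Real.log_nonpos hη.le (by linarith)
  have hl2 := Real.log_two_gt_d9
  set M := 3 * Real.log 2 + 1 - Real.log η with hMdef
  have M1 : 1 ≤ M := by linarith
  have hTe : 2 * T + 3 = 3 * Real.log (1 + k) - Real.log η + 1 + 2 * η := by
    rw [hT, Tval, show 1 - k = η by linarith]; linarith
  have hlk1 : Real.log (1 + k) ≤ Real.log 2 := Real.log_le_log (by linarith) (by linarith)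
  have hlk2 : Real.log 2 - η ≤ Real.log (1 + k) := by
    have := Real.one_sub_inv_le_log_of_pos (by linarith : 0 < (1 + k)/2)
    rw [Real.log_div (by linarith) (by norm_num)] at this
    have h3 : ((1 + k)/2)⁻¹ ≤ 1 + η := by
      rw [inv_le_iff_one_le_mul₀ (by linarith)]
      nlinarith
    linarith
  have hTM : 2 * T + 3 ≤ M + 2 * η := by linarith
  have hTM2 : M - 3 * η ≤ 2 * T + 3 := by linarith
  have X1 : v / η - M ≤ 8 * a * M := by
    rw [hX]
    have : (2 - η) * (q + 3/2) ≤ 2 * (q + 3/2) :=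
      mul_le_mul_of_nonneg_right (by linarith) (by linarith)
    have h5 : 2 * T ≤ M := by linarith
    have : 6 * a * (2 * T) ≤ 6 * a * M := mul_le_mul_of_nonneg_left h5 (by linarith)
    have : a ≤ a * M := le_mul_of_one_le_right ha0.le M1
    nlinarith
  have X2 : -(8 * a * M) ≤ v / η - M := by
    rw [hX]
    have h5 : q + 3/2 ≤ 2 * M := by
      have : T * (6 * a) ≤ T * 1 := mul_le_mul_of_nonneg_left (by linarith) T0
      linarith
    have h6 : η * (q + 3/2) ≤ a * (2 * M) := mul_le_mul hηa h5 (by linarith) ha0.le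
    have : a ≤ a * M := le_mul_of_one_le_right ha0.le M1
    linarith
  have X3 : |v / η - M| ≤ 8 * a * M := abs_le.2 ⟨X2, X1⟩
  calc _ ≤ 8 * a * M * M := mul_le_mul_of_nonneg_right X3 (by linarith)
    _ = 8 * M^2 * a := by ring
    _ ≤ 8 * M^2 * √(2 * η) := mul_le_mul_of_nonneg_left hasq (by positivity)
    _ ≤ 896 := by linarith

lemma A_pos {k : ℝ} (h0 : 0 < k) (h1 : k < 1) : 0 < Aint k := by
  apply intervalIntegral.intervalIntegral_pos_of_pos_on (wgt_int h0.le h1) _ h0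
  intro y hy
  obtain ⟨hP, hQ, hP2, hQ2, hw, hp, hq⟩ := pq_facts h1 hy
  rw [hw]; positivity

theorem stmt11 (c : ℝ) (hc : 0 < c) (f : ℝ → ℝ)
    (hmap : ∀ ξ ∈ Set.Icc (-c^2/2) (c^2/3), f ξ ∈ Set.Icc 0 c)
    (hcont : ContinuousOn f (Set.Icc (-c^2/2) (c^2/3)))
    (hmono : StrictMonoOn f (Set.Icc (-c^2/2) (c^2/3)))
    (hmod : ∀ ξ ∈ Set.Icc (-c^2/2) (c^2/3),
      c^2/2 + ξ = mu2 c (f ξ) + (f ξ)^2/2) :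
    ∃ C > 0, ∃ v₀ > 0, ∀ v : ℝ, 0 < v → v < v₀ →
      |(1 - f (c^2 * (1 - v) / 3) / c) -
          (v / Real.log (1/v)) *
            (1 - (Real.log (8 * Real.exp 1) + Real.log (Real.log (1/v))) /
              Real.log (1/v))|
        ≤ C * v * (Real.log (Real.log (1/v)))^2 / (Real.log (1/v))^3 := by
  refine ⟨72 + 896, by norm_num, Real.exp (-1000), Real.exp_pos _, ?_⟩
  intro v hv hv0
  have hl : 1000 ≤ Real.log (1/v) := by
    rw [one_div, Real.log_inv]
    have := (Real.log_lt_iff_lt_exp hv).2 hv0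
    linarith
  have hvs : v ≤ 1/1000 := by
    have h1 : 1000 + 1 ≤ Real.exp 1000 := Real.add_one_le_exp 1000
    rw [Real.exp_neg] at hv0
    have : (Real.exp 1000)⁻¹ ≤ 1/1000 := by
      rw [← one_div]
      exact one_div_le_one_div_of_le (by norm_num) (by linarith)
    linarith
  have hc2 : 0 < c^2 := by positivity
  have hmem : c^2 * (1 - v) / 3 ∈ Set.Icc (-c^2/2) (c^2/3) := by
    constructor <;> nlinarith
  have hmem2 : c^2/3 ∈ Set.Icc (-c^2/2) (c^2/3) := by
    constructor <;> nlinarith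
  have hd := hmap _ hmem
  have hlt : f (c^2 * (1 - v) / 3) < c :=
    lt_of_lt_of_le (hmono hmem hmem2 (by nlinarith)) (hmap _ hmem2).2
  have heq := hmod _ hmem
  obtain ⟨k, hk⟩ : ∃ k, k = f (c^2 * (1 - v) / 3) / c := ⟨_, rfl⟩
  have hfk : f (c^2 * (1 - v) / 3) = c * k := by rw [hk]; field_simp
  rw [← hk]
  rw [hfk] at hd heq hlt
  have h1 : k < 1 := by nlinarith
  have hk0 : 0 ≤ k := by
    have := hd.1
    exact nonneg_of_mul_nonneg_right this hc
  have h0 : 0 < k := by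
    rcases hk0.eq_or_lt with h | h
    · exfalso
      rw [← h] at heq
      simp [mu2] at heq
      nlinarith
    · exact h
  have hA := A_pos h0 h1
  rw [mu2_eq hc hk0 h1 hA.ne'] at heq
  have hq : 0 ≤ Dint k / Aint k := div_nonneg (D_nonneg hk0 h1) hA.le
  have heq2 : c^2 * v = c^2 * (3 * (Dint k / Aint k) + 3/2 * (1 - k^2)) := by linarith
  have heq3 := mul_left_cancel₀ hc2.ne' heq2
  apply final_step hv (by linarith : 0 < 1 - k) (by nlinarith) (by norm_num) hl (by linarith)
  apply XM_bound (by linarith) (by nlinarith) <;> rw [sub_sub_cancel]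
  · exact hA
  · exact heq3
end

section
/- Let c>0, and for 0<d<c define B_g(d) = 24·∫_d^c (y²−μ²(d))·√(y²−d²)/√(c²−y²) dy, where μ(d)≥0 satisfies μ²(d) = (∫₀^d y²·√((d²−y²)/(c²−y²)) dy)/(∫₀^d √((d²−y²)/(c²−y²)) dy). Then B_g(c(1−η)) = 8π·c³·η·(1 + O(η·log η)) as η→0⁺; that is, there exist constants C>0 and η₀>0 such that |B_g(c(1−η)) − 8π·c³·η| ≤ C·η²·log(1/η) for all 0<η<η₀. -/
/-- `B_g(d) = 24·∫_d^c (y²−μ²(d))·√(y²−d²)/√(c²−y²) dy`. -/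
noncomputable def Bg (c d : ℝ) : ℝ :=
  24 * ∫ y in d..c, (y^2 - mu2 c d) * Real.sqrt (y^2 - d^2) / Real.sqrt (c^2 - y^2)

/-- Integrability and value of the model integral. -/
lemma aux_K0 (d c : ℝ) (h : d < c) :
    IntervalIntegrable (fun y => √(y - d) / √(c - y)) MeasureTheory.volume d c ∧
    ∫ y in d..c, √(y - d) / √(c - y) = Real.pi / 2 * (c - d) := by
  have hw : 0 < c - d := by linarith
  set F : ℝ → ℝ := fun y => (c - d) / 2 * Real.arcsin ((2 * y - c - d) / (c - d))
    - √((y - d) * (c - y)) with hF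
  have hcont : Continuous F := by
    have := Real.continuous_arcsin
    fun_prop
  have hder : ∀ y ∈ Set.Ioo d c, HasDerivAt F (√(y - d) / √(c - y)) y := by
    intro y hy
    have h1 : 0 < y - d := by linarith [hy.1]
    have h2 : 0 < c - y := by linarith [hy.2]
    have hP : 0 < (y - d) * (c - y) := mul_pos h1 h2
    have ha : HasDerivAt (fun y : ℝ => (2 * y - c - d) / (c - d)) (2 / (c - d)) y := by
      have := ((((hasDerivAt_id y).const_mul 2).sub_const c).sub_const d).div_const (c - d)
      simpa using this
    have hb : HasDerivAt (fun y : ℝ => (y - d) * (c - y)) (c + d - 2 * y) y := by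
      have := ((hasDerivAt_id y).sub_const d).mul ((hasDerivAt_id y).const_sub c)
      refine this.congr_deriv ?_
      simp; ring
    have hne1 : (2 * y - c - d) / (c - d) ≠ -1 := by
      intro hh; rw [div_eq_iff hw.ne'] at hh; linarith
    have hne2 : (2 * y - c - d) / (c - d) ≠ 1 := by
      intro hh; rw [div_eq_iff hw.ne'] at hh; linarith
    have hc1 := ((Real.hasDerivAt_arcsin hne1 hne2).comp y ha).const_mul ((c - d) / 2)
    have hc2 := hb.sqrt hP.ne'
    have := hc1.sub hc2
    refine HasDerivAt.congr_deriv this ?_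
    have e1 : 1 - ((2 * y - c - d) / (c - d)) ^ 2
        = (2 * (√(y - d) * √(c - y)) / (c - d)) ^ 2 := by
      rw [div_pow, div_pow, mul_pow, mul_pow, Real.sq_sqrt h1.le, Real.sq_sqrt h2.le]
      field_simp; ring
    have s1 := Real.sqrt_pos.2 h1
    have s2 := Real.sqrt_pos.2 h2
    rw [e1, Real.sqrt_sq (by positivity), Real.sqrt_mul h1.le]
    field_simp
    rw [Real.sq_sqrt h1.le]; ring
  have hint : IntervalIntegrable (fun y => √(y - d) / √(c - y)) MeasureTheory.volume d c := by
    apply intervalIntegral.intervalIntegrable_deriv_of_nonneg (g := F) hcont.continuousOn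
    · simpa [min_eq_left h.le, max_eq_right h.le] using hder
    · intro y hy; positivity
  refine ⟨hint, ?_⟩
  rw [intervalIntegral.integral_eq_sub_of_hasDerivAt_of_le h.le hcont.continuousOn hder hint]
  have e1 : (2 * c - c - d) / (c - d) = 1 := by rw [div_eq_iff hw.ne']; ring
  have e2 : (2 * d - c - d) / (c - d) = -1 := by rw [div_eq_iff hw.ne']; ring
  simp only [hF, e1, e2, Real.arcsin_one, Real.arcsin_neg]
  simp; ring

/-- The estimate for `μ²`. -/
lemma aux_mu (c η : ℝ) (hc : 0 < c) (h0 : 0 < η) (h1 : η < 1/100) :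
    |mu2 c (c * (1 - η)) - c^2/3| ≤ 8 * c^2 * η * Real.log (1/η) := by
  set L := Real.log (1/η) with hL
  have hL1 : 1 ≤ L := by
    rw [hL, Real.le_log_iff_exp_le (by positivity), le_div_iff₀ h0]
    nlinarith [Real.exp_one_lt_d9, Real.exp_pos 1]
  have hLs : η * L ≤ 2 / 10 := by
    have hs : 0 < √η := Real.sqrt_pos.2 h0
    have hss : √η * √η = η := Real.mul_self_sqrt h0.le
    have : L = 2 * Real.log (1/√η) := by
      rw [hL, ← hss]
      rw [show 1 / (√η * √η) = (1/√η)^2 by field_simp, hss, Real.log_pow]; norm_num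
    have h3 : Real.log (1/√η) ≤ 1/√η := Real.log_le_self (by positivity)
    have h4 : √η ≤ 1/10 := by
      rw [Real.sqrt_le_left (by norm_num)]; linarith
    have h5 : η * (1/√η) = √η := by
      rw [mul_one_div, Real.div_sqrt]
    rw [this]
    nlinarith
  set d := c * (1 - η) with hd
  have hd0 : 0 < d := by apply mul_pos hc; linarith
  have hdc : d < c := by nlinarith
  set s : ℝ → ℝ := fun y => √((d^2 - y^2) / (c^2 - y^2)) with hs
  have hpos : ∀ y ∈ Set.Icc 0 d, 0 < c^2 - y^2 := fun y hy => by nlinarith [hy.1, hy.2]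
  have hscont : ContinuousOn s (Set.uIcc 0 d) := by
    rw [Set.uIcc_of_le hd0.le]
    apply ContinuousOn.sqrt
    exact ContinuousOn.div (by fun_prop) (by fun_prop) (fun y hy => (hpos y hy).ne')
  have hs1 : ∀ y ∈ Set.Icc 0 d, s y ≤ 1 := by
    intro y hy
    rw [hs]; simp only
    rw [Real.sqrt_le_left (by norm_num), one_pow, div_le_one (hpos y hy)]
    nlinarith
  have hs2 : ∀ y ∈ Set.Icc 0 d, 1 - s y ≤ 2 * c * η * (1 / (c - y)) := by
    intro y hy
    have hp := hpos y hy
    have hcy : 0 < c - y := by linarith [hy.2]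
    have hcy' : 0 < c + y := by linarith [hy.1]
    have ht0 : 0 ≤ (d^2 - y^2) / (c^2 - y^2) := by
      apply div_nonneg _ hp.le; nlinarith [hy.1, hy.2]
    have hss : s y * s y = (d^2 - y^2) / (c^2 - y^2) := Real.mul_self_sqrt ht0
    have hsn : 0 ≤ s y := Real.sqrt_nonneg _
    have h2 : (d^2 - y^2) / (c^2 - y^2) ≤ s y := by
      rw [← hss]; nlinarith [hs1 y hy]
    have h3 : 1 - (d^2 - y^2) / (c^2 - y^2) ≤ 2 * c * η * (1 / (c - y)) := by
      rw [show 1 - (d^2 - y^2) / (c^2 - y^2) = (c^2 - d^2)/(c^2 - y^2) by field_simp; ring,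
        mul_one_div, div_le_div_iff₀ hp hcy]
      have : c^2 - d^2 ≤ 2 * c * η * c := by rw [hd]; nlinarith [mul_pos hc hc, sq_nonneg (c*η)]
      calc (c^2 - d^2) * (c - y) ≤ (2 * c * η * c) * (c - y) := by gcongr
        _ ≤ (2 * c * η * (c + y)) * (c - y) := by
          gcongr; linarith [hy.1]
        _ = _ := by ring
    linarith
  have hlog : ∫ y in (0:ℝ)..d, 1 / (c - y) = L := by
    rw [intervalIntegral.integral_comp_sub_left (fun x => 1/x) c]
    rw [integral_one_div_of_pos (by linarith) (by linarith), hL]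
    congr 1
    rw [hd, show c - c * (1 - η) = c * η by ring, sub_zero]; field_simp
  have hic : ContinuousOn (fun y => 1 / (c - y)) (Set.uIcc 0 d) := by
    rw [Set.uIcc_of_le hd0.le]
    exact ContinuousOn.div (by fun_prop) (by fun_prop)
      (fun y hy => by have := hy.2; intro h; linarith)
  have iS : IntervalIntegrable s MeasureTheory.volume 0 d := hscont.intervalIntegrable
  have iY : IntervalIntegrable (fun y => y^2 * s y) MeasureTheory.volume 0 d :=
    ContinuousOn.intervalIntegrable (ContinuousOn.mul (by fun_prop) hscont)
  have iL : IntervalIntegrable (fun y => 2 * c * η * (1 / (c - y))) MeasureTheory.volume 0 d :=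
    ContinuousOn.intervalIntegrable (ContinuousOn.mul (by fun_prop) hic)
  have iL2 : IntervalIntegrable (fun y => c^2 * (2 * c * η * (1 / (c - y))))
    MeasureTheory.volume 0 d := iL.const_mul _
  set D := ∫ y in (0:ℝ)..d, s y with hD
  set N := ∫ y in (0:ℝ)..d, y^2 * s y with hN
  have iq : IntervalIntegrable (fun y : ℝ => y^2) MeasureTheory.volume 0 d :=
    Continuous.intervalIntegrable (by fun_prop) _ _
  have i1 : IntervalIntegrable (fun y : ℝ => (1:ℝ)) MeasureTheory.volume 0 d :=
    Continuous.intervalIntegrable (by fun_prop) _ _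
  have D1 : D ≤ d := by
    have := intervalIntegral.integral_mono_on hd0.le iS i1 hs1
    simpa using this
  have D2 : d - D ≤ 2 * c * η * L := by
    have := intervalIntegral.integral_mono_on hd0.le (i1.sub iS) iL hs2
    rw [intervalIntegral.integral_sub i1 iS, intervalIntegral.integral_const_mul, hlog] at this
    simpa using this
  have q : ∫ y in (0:ℝ)..d, y^2 = d^3/3 := by rw [integral_pow]; norm_num
  have N1 : N ≤ d^3/3 := by
    rw [← q]
    exact intervalIntegral.integral_mono_on hd0.le iY iq
      (fun y hy => mul_le_of_le_one_right (sq_nonneg y) (hs1 y hy))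
  have N2 : d^3/3 - N ≤ c^2 * (2 * c * η * L) := by
    have := intervalIntegral.integral_mono_on hd0.le (iq.sub iY) iL2 (fun y hy => by
      have a := hs2 y hy
      have b := hs1 y hy
      have e : y^2 ≤ c^2 := by linarith [hpos y hy]
      calc y^2 - y^2 * s y = y^2 * (1 - s y) := by ring
        _ ≤ c^2 * (1 - s y) := by apply mul_le_mul_of_nonneg_right e; linarith
        _ ≤ _ := by gcongr)
    rw [intervalIntegral.integral_sub iq iY, intervalIntegral.integral_const_mul,
      intervalIntegral.integral_const_mul, hlog, q] at this
    exact this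
  have hDpos : c/2 ≤ D := by
    have : c * (η * L) ≤ c * (2/10) := by gcongr
    have : c * η ≤ c * (1/100) := by gcongr
    nlinarith
  have hD0 : 0 < D := by linarith
  have hmu : mu2 c d = N / D := rfl
  have hηL : η ≤ η * L := by nlinarith
  have hd3 : |d^3/3 - c^2/3*d| ≤ c^3 * (2/3 * (η * L)) := by
    have e : d^3/3 - c^2/3*d = -(c^3 * ((1-η)*(η*(2-η))/3)) := by rw [hd]; ring
    rw [e, abs_neg, abs_of_nonneg]
    · gcongr; nlinarith [mul_pos h0 h0, mul_pos (mul_pos h0 h0) h0]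
    · have : 0 ≤ 1 - η := by linarith
      have : 0 ≤ 2 - η := by linarith
      positivity
  have hnum : |N - c^2/3*D| ≤ 4 * c^3 * (η * L) := by
    have hh := abs_le.1 hd3
    have c3 : 0 < c^3 * (η * L) := by positivity
    have x1 : c^2 * D ≤ c^2 * d := by gcongr
    have x2 : c^2 * (d - D) ≤ c^2 * (2 * c * η * L) := by gcongr
    rw [abs_le]; constructor <;> nlinarith
  rw [hmu, show N / D - c^2/3 = (N - c^2/3*D)/D by field_simp, abs_div, abs_of_pos hD0,
    div_le_iff₀ hD0]
  calc _ ≤ 4 * c^3 * (η * L) := hnum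
    _ = 8 * c^2 * η * L * (c/2) := by ring
    _ ≤ _ := by gcongr

theorem stmt12 (c : ℝ) (hc : 0 < c) :
    ∃ C > 0, ∃ η₀ > 0, ∀ η : ℝ, 0 < η → η < η₀ →
      |Bg c (c * (1 - η)) - 8 * Real.pi * c^3 * η| ≤ C * η^2 * Real.log (1/η) := by
  refine ⟨132 * Real.pi * c^3, by positivity, 1/100, by norm_num, fun η h0 h1 => ?_⟩
  have hmu := aux_mu c η hc h0 h1
  set L := Real.log (1/η) with hL
  have hL1 : 1 ≤ L := by
    rw [hL, Real.le_log_iff_exp_le (by positivity), le_div_iff₀ h0]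
    nlinarith [Real.exp_one_lt_d9, Real.exp_pos 1]
  have hηL : η ≤ η * L := by nlinarith
  set d := c * (1 - η) with hd
  have hd0 : 0 < d := by apply mul_pos hc; linarith
  have hdc : d < c := by nlinarith
  obtain ⟨i0, v0⟩ := aux_K0 d c hdc
  set m := mu2 c d with hm
  set g0 : ℝ → ℝ := fun y => √(y - d) / √(c - y) with hg0
  set f : ℝ → ℝ := fun y => (y^2 - m) * √(y^2 - d^2) / √(c^2 - y^2) with hf
  set E := 11 * c^2 * (η * L) with hE
  have key : ∀ y ∈ Set.Ioc d c, ‖f y - 2*c^2/3 * g0 y‖ ≤ E * g0 y := by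
    intro y hy
    have a1 : 0 < y - d := by linarith [hy.1]
    have a2 : 0 ≤ c - y := by linarith [hy.2]
    have a3 : 0 < y + d := by linarith
    have a4 : 0 < c + y := by linarith
    have hg : 0 ≤ g0 y := by positivity
    set r := √((y + d) / (c + y)) with hr
    have hfe : f y = (y^2 - m) * r * g0 y := by
      simp only [hf, hg0, hr]
      rw [show y^2 - d^2 = (y - d) * (y + d) by ring, show c^2 - y^2 = (c - y) * (c + y) by ring,
        Real.sqrt_mul a1.le, Real.sqrt_mul a2, Real.sqrt_div a3.le]
      simp only [div_eq_mul_inv, mul_inv]; ring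
    have hr0 : 0 ≤ r := Real.sqrt_nonneg _
    have hr1 : r ≤ 1 := by
      rw [hr, Real.sqrt_le_left (by norm_num), one_pow, div_le_one a4]; linarith
    have hrr : r * r = (y + d) / (c + y) := Real.mul_self_sqrt (by positivity)
    have hr2 : 1 - η ≤ r := by
      have : 1 - η ≤ (y + d) / (c + y) := by
        rw [le_div_iff₀ a4]; nlinarith [mul_pos h0 (hd0.trans hy.1)]
      nlinarith
    rw [hfe, ← sub_mul, Real.norm_eq_abs, abs_mul, abs_of_nonneg hg]
    refine mul_le_mul_of_nonneg_right ?_ hg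
    have b1 : |y^2 - c^2| ≤ 2 * c^2 * η := by
      have : c^2 - d^2 ≤ 2 * c^2 * η := by rw [hd]; nlinarith [sq_nonneg (c*η)]
      rw [abs_le]; constructor <;> nlinarith [hy.1, hy.2]
    have b2 : |1 - r| ≤ η := by rw [abs_le]; constructor <;> linarith
    have e : (y^2 - m) * r - 2*c^2/3 = ((y^2 - c^2) - (m - c^2/3)) * r - 2*c^2/3 * (1 - r) := by
      ring
    rw [e]
    calc _ ≤ |((y^2 - c^2) - (m - c^2/3)) * r| + |2*c^2/3 * (1 - r)| := abs_sub _ _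
      _ = |(y^2 - c^2) - (m - c^2/3)| * r + 2*c^2/3 * |1 - r| := by
        rw [abs_mul, abs_mul, abs_of_nonneg hr0, abs_of_nonneg (by positivity : 0 ≤ 2*c^2/3)]
      _ ≤ |(y^2 - c^2) - (m - c^2/3)| * 1 + 2*c^2/3 * η := by gcongr
      _ ≤ (|y^2 - c^2| + |m - c^2/3|) * 1 + 2*c^2/3 * η := by gcongr; exact abs_sub _ _
      _ ≤ (2 * c^2 * η + 8 * c^2 * η * L) * 1 + 2*c^2/3 * η := by gcongr
      _ ≤ E := by
        have : c^2 * η ≤ c^2 * (η * L) := by gcongr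
        rw [hE]; nlinarith [mul_pos (pow_pos hc 2) h0]
  have iE : IntervalIntegrable (fun y => E * g0 y) MeasureTheory.volume d c := i0.const_mul _
  have i2 : IntervalIntegrable (fun y => 2*c^2/3 * g0 y) MeasureTheory.volume d c :=
    i0.const_mul _
  have idiff : IntervalIntegrable (fun y => f y - 2*c^2/3 * g0 y) MeasureTheory.volume d c := by
    refine iE.mono_fun' ?_ ?_
    · apply Measurable.aestronglyMeasurable
      simp only [hf, hg0]
      fun_prop
    · rw [Set.uIoc_of_le hdc.le]
      exact (MeasureTheory.ae_restrict_iff' measurableSet_Ioc).2 (Filter.Eventually.of_forall key)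
  have hsum : ∫ y in d..c, f y = (∫ y in d..c, (f y - 2*c^2/3 * g0 y))
      + 2*c^2/3 * (Real.pi/2 * (c - d)) := by
    rw [← v0, ← intervalIntegral.integral_const_mul, ← intervalIntegral.integral_add idiff i2]
    congr 1; ext y; ring
  have hb := intervalIntegral.norm_integral_le_of_norm_le hdc.le
    (Filter.Eventually.of_forall key) iE
  rw [intervalIntegral.integral_const_mul, v0, Real.norm_eq_abs] at hb
  have hB : Bg c d = 24 * ∫ y in d..c, f y := rfl
  have hcd : c - d = c * η := by rw [hd]; ring
  rw [hcd] at hb hsum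
  rw [hB, hsum]
  set I := ∫ y in d..c, (f y - 2*c^2/3 * g0 y)
  rw [show 24 * (I + 2*c^2/3 * (Real.pi/2 * (c * η))) - 8 * Real.pi * c^3 * η = 24 * I by ring,
    abs_mul, abs_of_pos (by norm_num : (0:ℝ) < 24)]
  calc 24 * |I| ≤ 24 * (E * (Real.pi/2 * (c * η))) := by gcongr
    _ = _ := by rw [hE]; ring
end

section
/- Let c>0 and define, for t>0 and ξ near c²/3, z(t,ξ) = (t·B_g(f(ξ)) + Δ(f(ξ)))/π, and set v=1−3ξ/c². Then as v→0⁺, z(t,ξ) = 8c³·t·v/log(1/v) − 1/2 + O(1/log(1/v) + t·v·log log(1/v)/log²v); that is, there exist constants C>0 and v₀>0 such that for all t>0 and 0<v<v₀, |z(t,ξ) − 8c³tv/log(1/v) + 1/2| ≤ C·(1/log(1/v) + t·v·log log(1/v)/(log(1/v))²). In particular z(t,ξ) ≥ −1/2 for all t>0 and all sufficiently small v. -/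
/-- The phase variable `z(t,ξ) = (t·B_g(f(ξ)) + Δ(f(ξ)))/π`. -/
noncomputable def zvar (c : ℝ) (f : ℝ → ℝ) (t ξ : ℝ) : ℝ :=
  (t * Bg c (f ξ) + Delta c (f ξ)) / Real.pi


lemma ftc_nonneg {G g : ℝ → ℝ} {a b : ℝ} (hab : a ≤ b) (hG : ContinuousOn G (Set.Icc a b))
    (hd : ∀ y ∈ Set.Ioo a b, HasDerivAt G (g y) y) (hg : ∀ y ∈ Set.Ioo a b, 0 ≤ g y) :
    IntervalIntegrable g MeasureTheory.volume a b ∧ ∫ y in a..b, g y = G b - G a := by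
  have hi : IntervalIntegrable g MeasureTheory.volume a b := by
    apply intervalIntegral.intervalIntegrable_deriv_of_nonneg (g := G)
    · rwa [Set.uIcc_of_le hab]
    · simpa [hab] using hd
    · simpa [hab] using hg
  exact ⟨hi, intervalIntegral.integral_eq_sub_of_hasDerivAt_of_le hab hG hd hi⟩

lemma scale_int (c k l : ℝ) (hc : 0 < c) (F : ℝ → ℝ) :
    ∫ y in (c * k)..(c * l), F y = c * ∫ x in k..l, F (c * x) := by
  rw [intervalIntegral.integral_comp_mul_left _ hc.ne']
  simp [hc.ne']

lemma mu2_scale (c k : ℝ) (hc : 0 < c) : mu2 c (c * k) = c^2 * mu2 1 k := by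
  unfold mu2
  have h0 : (0:ℝ) = c * 0 := by simp
  have hs : ∀ x, Real.sqrt (((c*k)^2 - (c*x)^2) / (c^2 - (c*x)^2))
      = Real.sqrt ((k^2 - x^2) / (1^2 - x^2)) := by
    intro x
    congr 1
    rw [show (c*k)^2 - (c*x)^2 = c^2 * (k^2-x^2) by ring,
      show c^2 - (c*x)^2 = c^2 * (1^2-x^2) by ring, mul_div_mul_left _ _ (by positivity)]
  have e1 := scale_int c 0 k hc (fun y => y^2 * Real.sqrt (((c*k)^2 - y^2) / (c^2 - y^2)))
  have e2 := scale_int c 0 k hc (fun y => Real.sqrt (((c*k)^2 - y^2) / (c^2 - y^2)))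
  simp only [hs, mul_zero] at e1 e2
  rw [e1, e2]
  rw [mul_div_mul_left _ _ hc.ne', ← mul_div_assoc, ← intervalIntegral.integral_const_mul]
  simp only [mul_pow, mul_assoc]

lemma Bg_scale (c k : ℝ) (hc : 0 < c) : Bg c (c * k) = c^3 * Bg 1 k := by
  unfold Bg
  have e1 := scale_int c k 1 hc (fun y => (y^2 - mu2 c (c*k)) * Real.sqrt (y^2 - (c*k)^2) / Real.sqrt (c^2 - y^2))
  rw [mul_one] at e1
  rw [e1]
  have hs : ∀ x, ((c*x)^2 - mu2 c (c*k)) * Real.sqrt ((c*x)^2 - (c*k)^2) / Real.sqrt (c^2 - (c*x)^2)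
      = c^2 * ((x^2 - mu2 1 k) * Real.sqrt (x^2 - k^2) / Real.sqrt (1^2 - x^2)) := by
    intro x
    rw [mu2_scale c k hc, show (c*x)^2 - (c*k)^2 = c^2 * (x^2-k^2) by ring,
      show c^2 - (c*x)^2 = c^2 * (1^2-x^2) by ring, Real.sqrt_mul (by positivity),
      Real.sqrt_mul (by positivity), Real.sqrt_sq hc.le]
    rw [show ((c*x)^2 - c^2 * mu2 1 k) * (c * Real.sqrt (x^2-k^2))
      = c * (c^2 * ((x^2 - mu2 1 k) * Real.sqrt (x^2 - k^2))) by ring,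
      mul_div_mul_left _ _ hc.ne', mul_div_assoc]
  simp only [hs]
  rw [intervalIntegral.integral_const_mul]
  ring

lemma I1_scale (c k : ℝ) (hc : 0 < c) : I1 c (c * k) = c⁻¹ * I1 1 k := by
  unfold I1
  have e1 := scale_int c 0 k hc (fun y => 1 / Real.sqrt ((c^2 - y^2) * ((c*k)^2 - y^2)))
  rw [mul_zero] at e1
  rw [e1]
  have hs : ∀ x, 1 / Real.sqrt ((c^2 - (c*x)^2) * ((c*k)^2 - (c*x)^2))
      = (c^2)⁻¹ * (1 / Real.sqrt ((1^2 - x^2) * (k^2 - x^2))) := by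
    intro x
    rw [show (c^2 - (c*x)^2) * ((c*k)^2 - (c*x)^2) = (c^2)^2 * ((1^2 - x^2) * (k^2 - x^2)) by ring,
      Real.sqrt_mul (by positivity), Real.sqrt_sq (by positivity)]
    rw [one_div, mul_inv, one_div]
  simp only [hs]
  rw [intervalIntegral.integral_const_mul]
  field_simp

lemma I2_scale (c k : ℝ) (hc : 0 < c) : I2 c (c * k) = c⁻¹ * I2 1 k := by
  unfold I2
  have e1 := scale_int c k 1 hc (fun y => Real.log (c / (2 * Real.sqrt (c^2 - y^2))) /
    Real.sqrt ((c^2 - y^2) * (y^2 - (c*k)^2)))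
  rw [mul_one] at e1
  rw [e1]
  have hs : ∀ x, Real.log (c / (2 * Real.sqrt (c^2 - (c*x)^2))) /
      Real.sqrt ((c^2 - (c*x)^2) * ((c*x)^2 - (c*k)^2))
      = (c^2)⁻¹ * (Real.log (1 / (2 * Real.sqrt (1^2 - x^2))) /
      Real.sqrt ((1^2 - x^2) * (x^2 - k^2))) := by
    intro x
    rw [show (c^2 - (c*x)^2) * ((c*x)^2 - (c*k)^2) = (c^2)^2 * ((1^2 - x^2) * (x^2 - k^2)) by ring,
      Real.sqrt_mul (by positivity), Real.sqrt_sq (by positivity),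
      show c^2 - (c*x)^2 = c^2 * (1^2-x^2) by ring, Real.sqrt_mul (by positivity), Real.sqrt_sq hc.le,
      show c / (2 * (c * Real.sqrt (1^2-x^2))) = 1 / (2 * Real.sqrt (1^2-x^2)) by
        rw [show 2 * (c * Real.sqrt (1^2-x^2)) = c * (2 * Real.sqrt (1^2-x^2)) by ring]
        rw [← mul_div_mul_left 1 _ hc.ne', mul_one]]
    rw [div_mul_eq_div_div, div_eq_inv_mul _ (c^2), mul_div_assoc]
  simp only [hs]
  rw [intervalIntegral.integral_const_mul]
  field_simp

lemma Delta_scale (c k : ℝ) (hc : 0 < c) : Delta c (c * k) = Delta 1 k := by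
  unfold Delta
  rw [I1_scale c k hc, I2_scale c k hc, ← mul_neg, mul_div_mul_left _ _ (inv_ne_zero hc.ne')]

lemma logprim (d : ℝ) (hd0 : 0 < d) (hd1 : d < 1) :
    IntervalIntegrable (fun y => y / Real.sqrt ((1^2 - y^2) * (d^2 - y^2))) MeasureTheory.volume 0 d ∧
    ∫ y in (0:ℝ)..d, y / Real.sqrt ((1^2 - y^2) * (d^2 - y^2))
      = Real.log (1 + d) + Real.log (1 / (1 - d^2)) / 2 := by
  have hη : 0 < 1 - d^2 := by nlinarith
  have key := ftc_nonneg (G := fun y => - Real.log (Real.sqrt (1^2-y^2) + Real.sqrt (d^2-y^2)))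
    (g := fun y => y / Real.sqrt ((1^2 - y^2) * (d^2 - y^2))) hd0.le ?_ ?_ ?_
  · refine ⟨key.1, key.2.trans ?_⟩
    simp only [sub_self, Real.sqrt_zero, add_zero, one_pow]
    rw [Real.log_sqrt hη.le, one_div, Real.log_inv]
    simp [Real.sqrt_sq hd0.le]
    ring
  · apply ContinuousOn.neg
    apply ContinuousOn.log
    · fun_prop
    · intro y hy
      have : 0 < Real.sqrt (1^2-y^2) := Real.sqrt_pos.2 (by nlinarith [hy.1, hy.2])
      have := Real.sqrt_nonneg (d^2-y^2)
      positivity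
  · intro y hy
    have ha : 0 < 1^2 - y^2 := by nlinarith [hy.1, hy.2]
    have hb : 0 < d^2 - y^2 := by nlinarith [hy.1, hy.2]
    have h1 : HasDerivAt (fun y : ℝ => 1^2 - y^2) (-(2*y)) y := by
      exact ((hasDerivAt_pow 2 y).const_sub (1^2)).congr_deriv (by simp)
    have h2 : HasDerivAt (fun y : ℝ => d^2 - y^2) (-(2*y)) y := by
      exact ((hasDerivAt_pow 2 y).const_sub (d^2)).congr_deriv (by simp)
    have h3 := ((h1.sqrt ha.ne').add (h2.sqrt hb.ne')).log
      (by have := Real.sqrt_pos.2 ha; have := Real.sqrt_pos.2 hb; simp only [Pi.add_apply]; positivity)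
    refine h3.neg.congr_deriv ?_
    rw [Real.sqrt_mul ha.le]
    simp only [Pi.add_apply]
    have hA := Real.sqrt_pos.2 ha
    have hB := Real.sqrt_pos.2 hb
    generalize Real.sqrt (1^2-y^2) = A at *
    generalize Real.sqrt (d^2-y^2) = B at *
    field_simp
    ring
  · intro y hy
    exact div_nonneg hy.1.le (Real.sqrt_nonneg _)

lemma arcsinprim (d : ℝ) (hd0 : 0 < d) :
    IntervalIntegrable (fun y => 1 / Real.sqrt (d^2 - y^2)) MeasureTheory.volume 0 d ∧
    ∫ y in (0:ℝ)..d, 1 / Real.sqrt (d^2 - y^2) = Real.pi / 2 := by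
  have key := ftc_nonneg (G := fun y => Real.arcsin (y / d))
    (g := fun y => 1 / Real.sqrt (d^2 - y^2)) hd0.le ?_ ?_ ?_
  · refine ⟨key.1, key.2.trans ?_⟩
    simp [hd0.ne']
  · exact (Real.continuous_arcsin.comp (continuous_id.div_const d)).continuousOn
  · intro y hy
    have hb : 0 < d^2 - y^2 := by nlinarith [hy.1, hy.2]
    have hlt : y / d < 1 := (div_lt_one hd0).2 hy.2
    have hgt : 0 < y / d := div_pos hy.1 hd0
    have := (Real.hasDerivAt_arcsin (by linarith) hlt.ne).comp y ((hasDerivAt_id y).div_const d)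
    refine this.congr_deriv ?_
    rw [show d^2 - y^2 = d^2 * (1 - (y/d)^2) by field_simp, Real.sqrt_mul (by positivity), Real.sqrt_sq hd0.le]
    rw [div_mul_div_comm, one_mul, mul_comm]
  · intro y hy
    positivity

lemma I1_bounds (d : ℝ) (hd0 : 0 < d) (hd1 : d < 1) :
    Real.log (1 + d) + Real.log (1 / (1 - d^2)) / 2 ≤ I1 1 d ∧
    I1 1 d ≤ Real.log (1 + d) + Real.log (1 / (1 - d^2)) / 2 + Real.pi / 2 := by
  obtain ⟨i1, e1⟩ := logprim d hd0 hd1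
  obtain ⟨i2, e2⟩ := arcsinprim d hd0
  have hup : ∀ y ∈ Set.Ioo 0 d, 1 / Real.sqrt ((1^2 - y^2) * (d^2 - y^2)) ≤
      y / Real.sqrt ((1^2 - y^2) * (d^2 - y^2)) + 1 / Real.sqrt (d^2 - y^2) := by
    intro y hy
    have ha : 0 < 1^2 - y^2 := by nlinarith [hy.1, hy.2]
    have hb : 0 < d^2 - y^2 := by nlinarith [hy.1, hy.2]
    have hs : 1 - y ≤ Real.sqrt (1^2 - y^2) := by
      apply Real.le_sqrt_of_sq_le
      nlinarith [hy.1, hy.2]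
    rw [Real.sqrt_mul ha.le]
    have hA := Real.sqrt_pos.2 ha
    have hB := Real.sqrt_pos.2 hb
    generalize Real.sqrt (1^2-y^2) = A at *
    generalize Real.sqrt (d^2-y^2) = B at *
    rw [← sub_nonneg, show y / (A * B) + 1 / B - 1 / (A * B) = (A - (1-y)) / (A * B) by
        field_simp; ring]
    apply div_nonneg (by linarith) (by positivity)
  have i3 : IntervalIntegrable (fun y => 1 / Real.sqrt ((1^2 - y^2) * (d^2 - y^2))) MeasureTheory.volume 0 d := by
    rw [intervalIntegrable_iff_integrableOn_Ioo_of_le hd0.le]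
    have := (i1.add i2)
    rw [intervalIntegrable_iff_integrableOn_Ioo_of_le hd0.le] at this
    refine MeasureTheory.Integrable.mono' this ?_ ?_
    · apply Measurable.aestronglyMeasurable
      fun_prop
    · refine (MeasureTheory.ae_restrict_iff' measurableSet_Ioo).2 (Filter.Eventually.of_forall ?_)
      intro y hy
      rw [Real.norm_of_nonneg (by positivity)]
      exact hup y hy
  constructor
  · rw [← e1]
    apply intervalIntegral.integral_mono_on_of_le_Ioo hd0.le i1 i3
    intro y hy
    gcongr
    linarith [hy.2]
  · rw [← e1, ← e2, ← intervalIntegral.integral_add i1 i2]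
    exact intervalIntegral.integral_mono_on_of_le_Ioo hd0.le i3 (i1.add i2) hup

lemma w_cont (d : ℝ) (hd0 : 0 < d) (hd1 : d < 1) :
    ContinuousOn (fun y => Real.sqrt ((d^2 - y^2) / (1^2 - y^2))) (Set.uIcc 0 d) := by
  rw [Set.uIcc_of_le hd0.le]
  apply ContinuousOn.sqrt
  apply ContinuousOn.div (by fun_prop) (by fun_prop)
  intro y hy
  have : 0 < 1^2 - y^2 := by nlinarith [hy.1, hy.2]
  exact this.ne'

lemma kw_int (d : ℝ) (hd0 : 0 < d) (hd1 : d < 1) (k : ℝ → ℝ) (hk : Continuous k) :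
    IntervalIntegrable (fun y => k y * Real.sqrt ((d^2 - y^2) / (1^2 - y^2))) MeasureTheory.volume 0 d :=
  (hk.continuousOn.mul (w_cont d hd0 hd1)).intervalIntegrable

lemma yw_int (d : ℝ) (hd0 : 0 < d) (hd1 : d < 1) :
    ∫ y in (0:ℝ)..d, y * Real.sqrt ((d^2 - y^2) / (1^2 - y^2))
      = d / 2 - (1 - d^2) / 2 * Real.log (1 + d) - (1 - d^2) * Real.log (1 / (1 - d^2)) / 4 := by
  have hη : 0 < 1 - d^2 := by nlinarith
  have key := ftc_nonneg (G := fun y => (1 - d^2) / 2 * Real.log (Real.sqrt (1^2-y^2) + Real.sqrt (d^2-y^2))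
      - (Real.sqrt (1^2-y^2) * Real.sqrt (d^2-y^2)) / 2)
    (g := fun y => y * Real.sqrt ((d^2 - y^2) / (1^2 - y^2))) hd0.le ?_ ?_ ?_
  · refine key.2.trans ?_
    simp only [sub_self, Real.sqrt_zero, add_zero, one_pow]
    rw [Real.log_sqrt hη.le, one_div, Real.log_inv]
    simp [Real.sqrt_sq hd0.le]
    ring
  · apply ContinuousOn.sub _ (by fun_prop)
    apply ContinuousOn.mul (by fun_prop)
    apply ContinuousOn.log
    · fun_prop
    · intro y hy
      have : 0 < Real.sqrt (1^2-y^2) := Real.sqrt_pos.2 (by nlinarith [hy.1, hy.2])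
      have := Real.sqrt_nonneg (d^2-y^2)
      positivity
  · intro y hy
    have ha : 0 < 1^2 - y^2 := by nlinarith [hy.1, hy.2]
    have hb : 0 < d^2 - y^2 := by nlinarith [hy.1, hy.2]
    have h1 : HasDerivAt (fun y : ℝ => 1^2 - y^2) (-(2*y)) y := by
      exact ((hasDerivAt_pow 2 y).const_sub (1^2)).congr_deriv (by simp)
    have h2 : HasDerivAt (fun y : ℝ => d^2 - y^2) (-(2*y)) y := by
      exact ((hasDerivAt_pow 2 y).const_sub (d^2)).congr_deriv (by simp)
    have h3 := ((h1.sqrt ha.ne').add (h2.sqrt hb.ne')).log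
      (by have := Real.sqrt_pos.2 ha; have := Real.sqrt_pos.2 hb; simp only [Pi.add_apply]; positivity)
    have h4 := (h1.sqrt ha.ne').mul (h2.sqrt hb.ne')
    refine ((h3.const_mul ((1-d^2)/2)).sub (h4.div_const 2)).congr_deriv ?_
    rw [Real.sqrt_div hb.le]
    simp only [Pi.add_apply]
    have hA := Real.sqrt_pos.2 ha
    have hB := Real.sqrt_pos.2 hb
    have hA2 := Real.sq_sqrt ha.le
    have hB2 := Real.sq_sqrt hb.le
    have e : 1 - d^2 = Real.sqrt (1^2-y^2)^2 - Real.sqrt (d^2-y^2)^2 := by rw [hA2, hB2]; ring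
    rw [e]
    generalize Real.sqrt (1^2-y^2) = A at *
    generalize Real.sqrt (d^2-y^2) = B at *
    field_simp
    ring
  · intro y hy
    exact mul_nonneg hy.1.le (Real.sqrt_nonneg _)

lemma w_bounds (d y : ℝ) (hd1 : d < 1) (hy0 : 0 ≤ y) (hy1 : y ≤ d) :
    Real.sqrt ((d^2 - y^2) / (1^2 - y^2)) ≤ 1 ∧
    (d^2 - y^2) / (1^2 - y^2) ≤ Real.sqrt ((d^2 - y^2) / (1^2 - y^2)) := by
  have ha : 0 < 1^2 - y^2 := by nlinarith
  have hb : 0 ≤ d^2 - y^2 := by nlinarith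
  have h1 : (d^2 - y^2) / (1^2 - y^2) ≤ 1 := by
    rw [div_le_one ha]; nlinarith
  have h0 : 0 ≤ (d^2 - y^2) / (1^2 - y^2) := by positivity
  refine ⟨Real.sqrt_le_one.2 h1, Real.le_sqrt_of_sq_le ?_⟩
  nlinarith

lemma D_bounds (d : ℝ) (hd0 : 0 < d) (hd1 : d < 1) :
    1 - (1 - d^2) * Real.log (1 / (1 - d^2)) / 4 - 3 * (1 - d^2)
      ≤ ∫ y in (0:ℝ)..d, Real.sqrt ((d^2 - y^2) / (1^2 - y^2)) ∧
    ∫ y in (0:ℝ)..d, Real.sqrt ((d^2 - y^2) / (1^2 - y^2)) ≤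
      1 - (1 - d^2) * Real.log (1 / (1 - d^2)) / 4 := by
  have hη : 0 < 1 - d^2 := by nlinarith
  have hw := w_cont d hd0 hd1
  have e := yw_int d hd0 hd1
  have hsplit : ∫ y in (0:ℝ)..d, Real.sqrt ((d^2 - y^2) / (1^2 - y^2))
     = (∫ y in (0:ℝ)..d, y * Real.sqrt ((d^2 - y^2) / (1^2 - y^2)))
      + ∫ y in (0:ℝ)..d, (1 - y) * Real.sqrt ((d^2 - y^2) / (1^2 - y^2)) := by
    rw [← intervalIntegral.integral_add]
    · congr 1; ext y; ring
    · exact (continuousOn_id.mul hw).intervalIntegrable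
    · exact ((continuousOn_const.sub continuousOn_id).mul hw).intervalIntegrable
  have i1 : IntervalIntegrable (fun y => (1 - y) * Real.sqrt ((d^2 - y^2) / (1^2 - y^2))) MeasureTheory.volume 0 d :=
    ((continuousOn_const.sub continuousOn_id).mul hw).intervalIntegrable
  have hup : ∫ y in (0:ℝ)..d, (1 - y) * Real.sqrt ((d^2 - y^2) / (1^2 - y^2)) ≤ ∫ y in (0:ℝ)..d, (1 - y) := by
    apply intervalIntegral.integral_mono_on hd0.le i1 (Continuous.intervalIntegrable (by fun_prop) _ _)
    intro y hy
    have := (w_bounds d y hd1 hy.1 hy.2).1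
    nlinarith [hy.2]
  have hlo : ∫ y in (0:ℝ)..d, (1 - y - (1 - d^2)) ≤ ∫ y in (0:ℝ)..d, (1 - y) * Real.sqrt ((d^2 - y^2) / (1^2 - y^2)) := by
    apply intervalIntegral.integral_mono_on hd0.le (Continuous.intervalIntegrable (by fun_prop) _ _) i1
    intro y hy
    have h2 := (w_bounds d y hd1 hy.1 hy.2).2
    have ha : 0 < 1^2 - y^2 := by nlinarith [hy.1, hy.2]
    have : 1 - y - (1-d^2) ≤ (1 - y) * ((d^2 - y^2) / (1^2 - y^2)) := by
      rw [← mul_div_assoc, le_div_iff₀ ha]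
      have : 0 ≤ (1-d^2) * (y * (1-y)) := mul_nonneg hη.le (mul_nonneg hy.1 (by linarith [hy.2]))
      nlinarith [this]
    refine this.trans ?_
    exact mul_le_mul_of_nonneg_left h2 (by linarith [hy.2])
  have e1 : ∫ y in (0:ℝ)..d, (1 - y) = d - d^2/2 := by
    rw [intervalIntegral.integral_sub] <;> simp
  have e2 : ∫ y in (0:ℝ)..d, (1 - y - (1 - d^2)) = d - d^2/2 - (1-d^2) * d := by
    rw [intervalIntegral.integral_sub, e1]
    · simp; ring
    · exact Continuous.intervalIntegrable (by fun_prop) _ _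
    · simp
  rw [e1] at hup
  rw [e2] at hlo
  rw [hsplit, e]
  have hl0 : 0 ≤ Real.log (1+d) := Real.log_nonneg (by linarith)
  have hl1 : Real.log (1+d) ≤ d := by
    have := Real.log_le_sub_one_of_pos (show 0 < 1 + d by linarith); linarith
  have hl2 : (1-d^2) * Real.log (1+d) ≤ (1-d^2) * 1 := mul_le_mul_of_nonneg_left (by linarith) hη.le
  have hl3 : 0 ≤ (1-d^2) * Real.log (1+d) := mul_nonneg hη.le hl0
  constructor
  · nlinarith
  · nlinarith

lemma E_bounds (d : ℝ) (hd0 : 0 < d) (hd1 : d < 1) :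
    2/3 - 2 * (1 - d^2) ≤ (∫ y in (0:ℝ)..d, Real.sqrt ((d^2 - y^2) / (1^2 - y^2))) -
      (∫ y in (0:ℝ)..d, y^2 * Real.sqrt ((d^2 - y^2) / (1^2 - y^2))) ∧
    (∫ y in (0:ℝ)..d, Real.sqrt ((d^2 - y^2) / (1^2 - y^2))) -
      (∫ y in (0:ℝ)..d, y^2 * Real.sqrt ((d^2 - y^2) / (1^2 - y^2))) ≤ 2/3 := by
  have hw := w_cont d hd0 hd1
  have i0 := kw_int d hd0 hd1 (fun y => y^2) (by fun_prop)
  rw [← intervalIntegral.integral_sub hw.intervalIntegrable i0]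
  have i1 := hw.intervalIntegrable.sub i0
  have e1 : ∫ y in (0:ℝ)..d, (1 - y^2) = d - d^3/3 := by
    rw [intervalIntegral.integral_sub] <;> simp; norm_num
  have e2 : ∫ y in (0:ℝ)..d, (d^2 - y^2) = 2 * d^3/3 := by
    rw [intervalIntegral.integral_sub] <;> simp; ring
  have h9 : 0 ≤ (1-d) * (2 + 2*d - d^2) := mul_nonneg (by linarith) (by nlinarith)
  constructor
  · calc 2/3 - 2 * (1 - d^2) ≤ 2 * d^3/3 := by nlinarith [h9]
      _ = ∫ y in (0:ℝ)..d, (d^2 - y^2) := e2.symm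
      _ ≤ _ := by
        apply intervalIntegral.integral_mono_on hd0.le (Continuous.intervalIntegrable (by fun_prop) _ _) i1
        intro y hy
        have h2 := (w_bounds d y hd1 hy.1 hy.2).2
        have ha : 0 < 1^2 - y^2 := by nlinarith [hy.1, hy.2]
        rw [div_le_iff₀ ha] at h2
        linarith
  · calc _ ≤ ∫ y in (0:ℝ)..d, (1 - y^2) := by
          apply intervalIntegral.integral_mono_on hd0.le i1 (Continuous.intervalIntegrable (by fun_prop) _ _)
          intro y hy
          have h2 := (w_bounds d y hd1 hy.1 hy.2).1
          have ha : 0 < 1^2 - y^2 := by nlinarith [hy.1, hy.2]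
          nlinarith
      _ = _ := e1
      _ ≤ _ := by nlinarith [mul_nonneg (sub_nonneg.2 hd1.le) (sq_nonneg (1-d)), sq_nonneg (1-d)]

lemma eta_log (η : ℝ) (h0 : 0 < η) (h1 : η ≤ 1/100) :
    0 < Real.log (1/η) ∧ η * Real.log (1/η) ≤ 2 * Real.sqrt η ∧
    η * Real.log (1/η) ≤ 1/5 ∧ (η * Real.log (1/η))^2 ≤ 4 * η := by
  have hp : 0 < Real.log (1/η) := Real.log_pos (by rw [lt_div_iff₀ h0]; linarith)
  have hs : 0 < Real.sqrt η := Real.sqrt_pos.2 h0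
  have hs2 := Real.sq_sqrt h0.le
  have hl : Real.log (1/η) ≤ 2 * (1 / Real.sqrt η) := by
    have : 1/η = (1/Real.sqrt η)^2 := by rw [div_pow, hs2, one_pow]
    rw [this, Real.log_pow]
    have := Real.log_le_sub_one_of_pos (show 0 < 1/Real.sqrt η by positivity)
    push_cast
    linarith
  have h2 : η * Real.log (1/η) ≤ 2 * Real.sqrt η := by
    calc η * Real.log (1/η) ≤ η * (2 * (1 / Real.sqrt η)) := mul_le_mul_of_nonneg_left hl h0.le
      _ = (Real.sqrt η)^2 * (2 * (1 / Real.sqrt η)) := by rw [hs2]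
      _ = 2 * Real.sqrt η := by field_simp
  have h3 : Real.sqrt η ≤ 1/10 := by
    apply Real.sqrt_le_iff.2; constructor <;> linarith
  have hn : 0 ≤ η * Real.log (1/η) := by positivity
  refine ⟨hp, h2, by linarith, ?_⟩
  calc (η * Real.log (1/η))^2 ≤ (2 * Real.sqrt η)^2 := by gcongr
    _ = 4 * η := by rw [mul_pow, hs2]; norm_num

lemma mu2_asymp (d : ℝ) (hd0 : 0 < d) (hd1 : d < 1) (hη : 1 - d^2 ≤ 1/100) :
    |mu2 1 d - 1/3 + (1 - d^2) * Real.log (1/(1-d^2)) / 6| ≤ 5 * (1 - d^2) := by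
  have hη0 : 0 < 1 - d^2 := by nlinarith
  obtain ⟨l1, l2, l3, l4⟩ := eta_log (1-d^2) hη0 hη
  obtain ⟨D1, D2⟩ := D_bounds d hd0 hd1
  obtain ⟨E1, E2⟩ := E_bounds d hd0 hd1
  have hP : 0 < (1-d^2) * Real.log (1/(1-d^2)) := by positivity
  unfold mu2
  generalize (∫ y in (0:ℝ)..d, Real.sqrt ((d^2 - y^2) / (1^2 - y^2))) = D at *
  generalize (∫ y in (0:ℝ)..d, y^2 * Real.sqrt ((d^2 - y^2) / (1^2 - y^2))) = N at *
  generalize (1-d^2) * Real.log (1/(1-d^2)) = P at *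
  generalize 1-d^2 = η at *
  have hD : 1/2 ≤ D := by linarith
  have : N / D - 1/3 + P/6 = (N - D/3 + P/6*D) / D := by field_simp
  rw [this, abs_div, abs_of_pos (show 0 < D by linarith), div_le_iff₀ (by linarith), abs_le]
  constructor
  · nlinarith
  · nlinarith

lemma mu2_le (d : ℝ) (hd0 : 0 < d) (hd1 : d < 1) : mu2 1 d ≤ d^2/3 := by
  unfold mu2
  have hw := w_cont d hd0 hd1
  apply div_le_of_le_mul₀
  · apply intervalIntegral.integral_nonneg hd0.le
    intro y _
    positivity
  · positivity
  have i2 := kw_int d hd0 hd1 (fun y => y^2) (by fun_prop)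
  have i3 := kw_int d hd0 hd1 (fun y => d^2/3) (by fun_prop)
  rw [← sub_nonpos, ← intervalIntegral.integral_const_mul, ← intervalIntegral.integral_sub i2 i3]
  have i1 := i2.sub i3
  set W := Real.sqrt ((d^2 - d^2/3) / (1^2 - d^2/3)) with hW
  have e2 : ∫ y in (0:ℝ)..d, W * (y^2 - d^2/3) = 0 := by
    rw [intervalIntegral.integral_const_mul, intervalIntegral.integral_sub] <;> simp
    right; ring
  refine le_trans ?_ e2.le
  apply intervalIntegral.integral_mono_on hd0.le i1 (Continuous.intervalIntegrable (by fun_prop) _ _)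
  intro y hy
  have ha : 0 < 1^2 - y^2 := by nlinarith [hy.1, hy.2]
  have ha' : 0 < 1^2 - d^2/3 := by nlinarith
  have hdd : d^2 < 1 := by nlinarith
  rcases le_total (y^2) (d^2/3) with h | h
  · have : W ≤ Real.sqrt ((d^2 - y^2) / (1^2 - y^2)) := by
      apply Real.sqrt_le_sqrt
      rw [div_le_div_iff₀ ha' ha]
      nlinarith
    nlinarith
  · have : Real.sqrt ((d^2 - y^2) / (1^2 - y^2)) ≤ W := by
      apply Real.sqrt_le_sqrt
      rw [div_le_div_iff₀ ha ha']
      nlinarith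
    nlinarith

lemma J_int (d : ℝ) (hd0 : 0 < d) (hd1 : d < 1) :
    IntervalIntegrable (fun y => y * (Real.sqrt (y^2 - d^2) / Real.sqrt (1^2 - y^2))) MeasureTheory.volume d 1 ∧
    ∫ y in d..1, y * (Real.sqrt (y^2 - d^2) / Real.sqrt (1^2 - y^2)) = (1 - d^2) * Real.pi / 4 := by
  have hη : 0 < 1 - d^2 := by nlinarith
  have key := ftc_nonneg (G := fun y => (1 - d^2) / 4 * Real.arcsin ((2*y^2 - 1 - d^2)/(1-d^2))
      - (Real.sqrt (1^2-y^2) * Real.sqrt (y^2-d^2)) / 2)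
    (g := fun y => y * (Real.sqrt (y^2 - d^2) / Real.sqrt (1^2 - y^2))) hd1.le ?_ ?_ ?_
  · refine ⟨key.1, key.2.trans ?_⟩
    have e1 : (2*1^2 - 1 - d^2)/(1-d^2) = 1 := by rw [div_eq_one_iff_eq hη.ne']; ring
    have e2 : (2*d^2 - 1 - d^2)/(1-d^2) = -1 := by rw [div_eq_iff hη.ne']; ring
    simp only [e1, e2, sub_self, Real.sqrt_zero, Real.arcsin_one, Real.arcsin_neg]
    ring
  · apply ContinuousOn.sub _ (by fun_prop)
    apply ContinuousOn.mul (by fun_prop)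
    exact (Real.continuous_arcsin.comp (by fun_prop)).continuousOn
  · intro y hy
    have hy0 : 0 < y := hd0.trans hy.1
    have ha : 0 < 1^2 - y^2 := by nlinarith [hy.1, hy.2]
    have hb : 0 < y^2 - d^2 := by nlinarith [hy.1, hy.2]
    have h1 : HasDerivAt (fun y : ℝ => 1^2 - y^2) (-(2*y)) y :=
      ((hasDerivAt_pow 2 y).const_sub (1^2)).congr_deriv (by simp)
    have h2 : HasDerivAt (fun y : ℝ => y^2 - d^2) (2*y) y :=
      ((hasDerivAt_pow 2 y).sub_const (d^2)).congr_deriv (by simp)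
    have h5 : HasDerivAt (fun y : ℝ => (2*y^2 - 1 - d^2)/(1-d^2)) (4*y/(1-d^2)) y :=
      (((((hasDerivAt_pow 2 y).const_mul 2).sub_const 1).sub_const (d^2)).div_const (1-d^2)).congr_deriv
        (by simp; ring)
    have hg : 1 - ((2*y^2 - 1 - d^2)/(1-d^2))^2 = (2/(1-d^2))^2 * ((1^2-y^2) * (y^2-d^2)) := by
      field_simp; ring
    have hg0 : 0 < 1 - ((2*y^2 - 1 - d^2)/(1-d^2))^2 := by rw [hg]; positivity
    have h3 := (Real.hasDerivAt_arcsin (x := (2*y^2 - 1 - d^2)/(1-d^2))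
      (by intro h; rw [h] at hg0; norm_num at hg0) (by intro h; rw [h] at hg0; norm_num at hg0)).comp y h5
    rw [hg, Real.sqrt_mul (by positivity), Real.sqrt_sq (by positivity), Real.sqrt_mul ha.le] at h3
    have h4 := (h1.sqrt ha.ne').mul (h2.sqrt hb.ne')
    refine ((h3.const_mul ((1-d^2)/4)).sub (h4.div_const 2)).congr_deriv ?_
    have hA := Real.sqrt_pos.2 ha
    have hB := Real.sqrt_pos.2 hb
    have hA2 := Real.sq_sqrt ha.le
    have hB2 := Real.sq_sqrt hb.le
    have e : 1 - d^2 = Real.sqrt (1^2-y^2)^2 + Real.sqrt (y^2-d^2)^2 := by rw [hA2, hB2]; ring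
    rw [e]
    generalize Real.sqrt (1^2-y^2) = A at *
    generalize Real.sqrt (y^2-d^2) = B at *
    field_simp
    ring
  · intro y hy
    have hy0 : 0 < y := hd0.trans hy.1
    positivity

lemma Bg_asymp (d : ℝ) (hd0 : 99/100 ≤ d) (hd1 : d < 1) :
    |Bg 1 d - 4 * Real.pi * (1 - d^2)| ≤
      6 * Real.pi * (1-d^2) * (3 * (1-d^2) + 2 * |mu2 1 d - 1/3|) := by
  have hη : 0 < 1 - d^2 := by nlinarith
  obtain ⟨i1, e1⟩ := J_int d (by linarith) hd1
  unfold Bg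
  generalize mu2 1 d = m
  set B := 3 * (1-d^2) + 2 * |m - 1/3| with hB
  have hB0 : 0 ≤ B := by positivity
  have hb : ∀ y ∈ Set.Ioo d 1, (2/3 - B) * y ≤ y^2 - m ∧ y^2 - m ≤ (2/3 + B) * y := by
    intro y hy
    have hy0 : 1/2 < y := by linarith [hy.1]
    have m1 := le_abs_self (m - 1/3)
    have m2 := neg_abs_le (m - 1/3)
    have hd : 1 - d ≤ 1 - d^2 := by nlinarith
    have hyy : y - y^2 ≤ 1 - d^2 := by nlinarith [hy.1, hy.2]
    have hyy0 : 0 ≤ y - y^2 := by nlinarith [hy.1, hy.2]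
    have hyB : B/2 ≤ B * y := by nlinarith
    constructor
    · nlinarith [hy.1, hy.2]
    · nlinarith [hy.1, hy.2]
  have hb2 : ∀ y ∈ Set.Ioo d 1,
      (2/3 - B) * (y * (Real.sqrt (y^2 - d^2) / Real.sqrt (1^2 - y^2))) ≤ (y^2 - m) * Real.sqrt (y^2 - d^2) / Real.sqrt (1^2 - y^2) ∧
      (y^2 - m) * Real.sqrt (y^2 - d^2) / Real.sqrt (1^2 - y^2) ≤ (2/3 + B) * (y * (Real.sqrt (y^2 - d^2) / Real.sqrt (1^2 - y^2))) := by
    intro y hy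
    obtain ⟨p, q⟩ := hb y hy
    have hw : 0 ≤ Real.sqrt (y^2 - d^2) / Real.sqrt (1^2 - y^2) := by positivity
    rw [mul_div_assoc, ← mul_assoc, ← mul_assoc]
    exact ⟨mul_le_mul_of_nonneg_right p hw, mul_le_mul_of_nonneg_right q hw⟩
  have i2 : IntervalIntegrable (fun y => (y^2 - m) * Real.sqrt (y^2 - d^2) / Real.sqrt (1^2 - y^2)) MeasureTheory.volume d 1 := by
    have := i1.const_mul (2/3 + B)
    rw [intervalIntegrable_iff_integrableOn_Ioo_of_le hd1.le] at this ⊢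
    refine MeasureTheory.Integrable.mono' this ?_ ?_
    · apply Measurable.aestronglyMeasurable
      fun_prop
    · refine (MeasureTheory.ae_restrict_iff' measurableSet_Ioo).2 (Filter.Eventually.of_forall ?_)
      intro y hy
      have hw : 0 ≤ y * (Real.sqrt (y^2 - d^2) / Real.sqrt (1^2 - y^2)) :=
        mul_nonneg (by linarith [hy.1]) (by positivity)
      obtain ⟨p, q⟩ := hb2 y hy
      rw [Real.norm_eq_abs, abs_le]
      refine ⟨?_, q⟩
      nlinarith
  have u := intervalIntegral.integral_mono_on_of_le_Ioo hd1.le i2 (i1.const_mul (2/3 + B)) (fun y hy => (hb2 y hy).2)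
  have l := intervalIntegral.integral_mono_on_of_le_Ioo hd1.le (i1.const_mul (2/3 - B)) i2 (fun y hy => (hb2 y hy).1)
  rw [intervalIntegral.integral_const_mul, e1] at u l
  rw [abs_le]
  constructor <;> nlinarith

lemma Bg_nonneg (d : ℝ) (hd0 : 0 < d) (hd1 : d < 1) : 0 ≤ Bg 1 d := by
  unfold Bg
  have hm := mu2_le d hd0 hd1
  apply mul_nonneg (by norm_num)
  apply intervalIntegral.integral_nonneg hd1.le
  intro y hy
  have : 0 ≤ y^2 - mu2 1 d := by nlinarith [hy.1]
  positivity

lemma I2_subst (d : ℝ) (hd0 : 0 < d) (hd1 : d < 1) :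
    I2 1 d = ∫ θ in (0:ℝ)..(Real.pi/2), (Real.log (1 / (2 * Real.sqrt (1-d^2))) - Real.log (Real.sin θ))
      / Real.sqrt (1 - (1-d^2) * Real.sin θ ^ 2) := by
  have hη : 0 < 1 - d^2 := by nlinarith
  have hpi := Real.pi_pos
  have hsin : ∀ θ ∈ Set.Ioo 0 (Real.pi/2), 0 < Real.sin θ ∧ 0 < Real.cos θ := fun θ hθ =>
    ⟨Real.sin_pos_of_pos_of_lt_pi hθ.1 (by linarith [hθ.2]),
      Real.cos_pos_of_mem_Ioo ⟨by linarith [hθ.1], hθ.2⟩⟩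
  have hpos : ∀ θ, 0 < 1 - (1-d^2) * Real.sin θ ^ 2 := by
    intro θ
    nlinarith [Real.sin_sq_le_one θ, sq_nonneg (Real.sin θ)]
  let F := fun θ => Real.sqrt (1 - (1-d^2) * Real.sin θ ^ 2)
  have himg : F '' Set.Ioo 0 (Real.pi/2) = Set.Ioo d 1 := by
    ext y
    constructor
    · rintro ⟨θ, hθ, rfl⟩
      obtain ⟨hs, hc⟩ := hsin θ hθ
      have := Real.sin_sq_add_cos_sq θ
      have hs1 : 0 < Real.sin θ ^ 2 := by positivity
      have hc1 : 0 < Real.cos θ ^ 2 := by positivity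
      constructor
      · apply Real.lt_sqrt_of_sq_lt
        nlinarith
      · rw [Real.sqrt_lt' one_pos]
        nlinarith
    · intro hy
      have hy0 : 0 < y := hd0.trans hy.1
      have hr0 : 0 < (1 - y^2)/(1-d^2) := div_pos (by nlinarith [hy.2]) hη
      have hr1 : (1 - y^2)/(1-d^2) < 1 := by rw [div_lt_one hη]; nlinarith [hy.1]
      have hq0 := Real.sqrt_pos.2 hr0
      have hq1 : Real.sqrt ((1 - y^2)/(1-d^2)) < 1 := by
        rw [Real.sqrt_lt' one_pos]; simpa using hr1
      refine ⟨Real.arcsin (Real.sqrt ((1 - y^2)/(1-d^2))), ⟨Real.arcsin_pos.2 hq0, Real.arcsin_lt_pi_div_two.2 hq1⟩, ?_⟩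
      simp only [F]
      rw [Real.sin_arcsin (by linarith) hq1.le, Real.sq_sqrt hr0.le, mul_div_cancel₀ _ hη.ne']
      rw [show 1 - (1 - y^2) = y^2 by ring, Real.sqrt_sq hy0.le]
  have hinj : Set.InjOn F (Set.Ioo 0 (Real.pi/2)) := by
    intro x hx y hy hxy
    have h1 := (Real.sqrt_inj (hpos x).le (hpos y).le).1 hxy
    obtain ⟨hsx, _⟩ := hsin x hx
    obtain ⟨hsy, _⟩ := hsin y hy
    have h2 : Real.sin x ^ 2 = Real.sin y ^ 2 := by
      apply mul_left_cancel₀ hη.ne'; linarith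
    have h3 : Real.sin x = Real.sin y := by
      rwa [sq_eq_sq₀ hsx.le hsy.le] at h2
    exact Real.injOn_sin ⟨by linarith [hx.1], hx.2.le⟩ ⟨by linarith [hy.1], hy.2.le⟩ h3
  have hder : ∀ θ ∈ Set.Ioo 0 (Real.pi/2), HasDerivWithinAt F
      (-((1-d^2) * Real.sin θ * Real.cos θ) / Real.sqrt (1 - (1-d^2) * Real.sin θ ^ 2)) (Set.Ioo 0 (Real.pi/2)) θ := by
    intro θ hθ
    have := ((((Real.hasDerivAt_sin θ).pow 2).const_mul (1-d^2)).const_sub 1).sqrt (hpos θ).ne'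
    refine (this.congr_deriv ?_).hasDerivWithinAt
    have := Real.sqrt_pos.2 (hpos θ)
    simp only [Pi.pow_apply]
    generalize Real.sqrt (1 - (1-d^2) * Real.sin θ ^ 2) = q at *
    field_simp
    simp
    ring
  unfold I2
  rw [intervalIntegral.integral_of_le hd1.le, MeasureTheory.integral_Ioc_eq_integral_Ioo, ← himg,
    MeasureTheory.integral_image_eq_integral_abs_deriv_smul measurableSet_Ioo hder hinj,
    intervalIntegral.integral_of_le (by linarith), MeasureTheory.integral_Ioc_eq_integral_Ioo]
  apply MeasureTheory.setIntegral_congr_fun measurableSet_Ioo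
  intro θ hθ
  obtain ⟨hs, hc⟩ := hsin θ hθ
  have hq := Real.sqrt_pos.2 (hpos θ)
  have hr := Real.sqrt_pos.2 hη
  simp only [F, smul_eq_mul]
  rw [Real.sq_sqrt (hpos θ).le, show 1^2 - (1 - (1-d^2) * Real.sin θ ^ 2) = (1-d^2) * Real.sin θ ^ 2 by ring,
    show 1 - (1-d^2) * Real.sin θ ^ 2 - d^2 = (1-d^2) * Real.cos θ ^ 2 by
      rw [Real.sin_sq]; ring,
    show (1-d^2) * Real.sin θ ^ 2 * ((1-d^2) * Real.cos θ ^ 2) = ((1-d^2) * Real.sin θ * Real.cos θ)^2 by ring,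
    Real.sqrt_sq (by positivity), Real.sqrt_mul hη.le, Real.sqrt_sq hs.le, neg_div, abs_neg,
    abs_of_pos (by positivity), ← mul_assoc,
    ← div_div 1 (2 * Real.sqrt (1-d^2)) (Real.sin θ), Real.log_div (by positivity) hs.ne']
  generalize Real.log (1 / (2 * Real.sqrt (1-d^2))) - Real.log (Real.sin θ) = X at *
  generalize Real.sqrt (1 - (1-d^2) * Real.sin θ ^ 2) = q at *
  field_simp

lemma I2_bounds (d : ℝ) (hd0 : 0 < d) (hd1 : d < 1) (hη4 : 1 - d^2 ≤ 1/4) :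
    Real.pi / 4 * Real.log (1 / (1-d^2)) ≤ I2 1 d ∧
    d * I2 1 d ≤ Real.pi / 4 * Real.log (1 / (1-d^2)) := by
  have hη : 0 < 1 - d^2 := by nlinarith
  have hpi := Real.pi_pos
  have hK : 0 ≤ Real.log (1 / (2 * Real.sqrt (1-d^2))) := by
    apply Real.log_nonneg
    have hr := Real.sqrt_pos.2 hη
    rw [le_div_iff₀ (by positivity)]
    have : Real.sqrt (1-d^2) ≤ 1/2 := Real.sqrt_le_iff.2 ⟨by norm_num, by linarith⟩
    linarith
  have hKe : Real.log (1 / (2 * Real.sqrt (1-d^2))) = Real.log (1/(1-d^2)) / 2 - Real.log 2 := by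
    have hr := Real.sqrt_pos.2 hη
    rw [← div_div, Real.log_div (by positivity) hr.ne', Real.log_sqrt hη.le, one_div, one_div, Real.log_inv, Real.log_inv]
    ring
  rw [I2_subst d hd0 hd1]
  set K := Real.log (1 / (2 * Real.sqrt (1-d^2))) with hKdef
  have i0 : IntervalIntegrable (fun θ => Real.log (Real.sin θ)) MeasureTheory.volume 0 (Real.pi/2) :=
    intervalIntegrable_log_sin
  have i1 : IntervalIntegrable (fun θ => K - Real.log (Real.sin θ)) MeasureTheory.volume 0 (Real.pi/2) :=
    (intervalIntegrable_const).sub i0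
  have e1 : ∫ θ in (0:ℝ)..(Real.pi/2), (K - Real.log (Real.sin θ)) = Real.pi / 4 * Real.log (1 / (1-d^2)) := by
    rw [intervalIntegral.integral_sub intervalIntegrable_const i0,
      integral_log_sin_zero_pi_div_two, hKe]
    simp
    ring
  have hn : ∀ θ, 0 ≤ K - Real.log (Real.sin θ) := by
    intro θ
    have : Real.log (Real.sin θ) ≤ 0 := by
      rw [← Real.log_abs]
      exact Real.log_nonpos (abs_nonneg _) (Real.abs_sin_le_one θ)
    linarith
  have hq : ∀ θ, d ≤ Real.sqrt (1 - (1-d^2) * Real.sin θ ^ 2) ∧ Real.sqrt (1 - (1-d^2) * Real.sin θ ^ 2) ≤ 1 := by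
    intro θ
    have := Real.sin_sq_le_one θ
    have h2 := sq_nonneg (Real.sin θ)
    constructor
    · apply Real.le_sqrt_of_sq_le; nlinarith
    · apply Real.sqrt_le_one.2; nlinarith
  have hup : ∀ θ, (K - Real.log (Real.sin θ)) / Real.sqrt (1 - (1-d^2) * Real.sin θ ^ 2) ≤ d⁻¹ * (K - Real.log (Real.sin θ)) := by
    intro θ
    rw [← div_eq_inv_mul]
    exact div_le_div_of_nonneg_left (hn θ) hd0 (hq θ).1
  have hlo : ∀ θ, (K - Real.log (Real.sin θ)) ≤ (K - Real.log (Real.sin θ)) / Real.sqrt (1 - (1-d^2) * Real.sin θ ^ 2) := by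
    intro θ
    apply le_div_self (hn θ) (lt_of_lt_of_le hd0 (hq θ).1) (hq θ).2
  have i2 : IntervalIntegrable (fun θ => (K - Real.log (Real.sin θ)) / Real.sqrt (1 - (1-d^2) * Real.sin θ ^ 2)) MeasureTheory.volume 0 (Real.pi/2) := by
    have := i1.const_mul d⁻¹
    rw [intervalIntegrable_iff_integrableOn_Ioo_of_le (by linarith)] at this ⊢
    refine MeasureTheory.Integrable.mono' this ?_ ?_
    · apply Measurable.aestronglyMeasurable
      fun_prop
    · refine Filter.Eventually.of_forall ?_
      intro θ
      rw [Real.norm_of_nonneg (div_nonneg (hn θ) (Real.sqrt_nonneg _))]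
      exact hup θ
  constructor
  · rw [← e1]
    exact intervalIntegral.integral_mono_on (by linarith) i1 i2 (fun θ _ => hlo θ)
  · have := intervalIntegral.integral_mono_on (by linarith) i2 (i1.const_mul d⁻¹) (fun θ _ => hup θ)
    rw [intervalIntegral.integral_const_mul, e1] at this
    calc _ ≤ d * (d⁻¹ * (Real.pi / 4 * Real.log (1 / (1-d^2)))) := mul_le_mul_of_nonneg_left this hd0.le
      _ = _ := by field_simp

lemma Delta_core (d : ℝ) (hd0 : 0 < d) (hd1 : d < 1) (hη : 1 - d^2 ≤ 1/100) :
    0 ≤ Delta 1 d / Real.pi + 1/2 ∧ Delta 1 d / Real.pi + 1/2 ≤ 3 / Real.log (1/(1-d^2)) := by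
  have hη0 : 0 < 1 - d^2 := by nlinarith
  have hd99 : 99/100 ≤ d := by nlinarith
  have hpi := Real.pi_pos
  have hpi4 := Real.pi_le_four
  obtain ⟨l1, l2, l3, l4⟩ := eta_log (1-d^2) hη0 hη
  obtain ⟨A1, A2⟩ := I1_bounds d hd0 hd1
  obtain ⟨B1, B2⟩ := I2_bounds d hd0 hd1 (by linarith)
  have hl1 : Real.log (1+d) ≤ d := by
    have := Real.log_le_sub_one_of_pos (show 0 < 1 + d by linarith); linarith
  have hl0 : 49/100 ≤ Real.log (1+d) := by
    have h := Real.one_sub_inv_le_log_of_pos (show 0 < 1 + d by linarith)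
    have : (1+d)⁻¹ ≤ 51/100 := by
      rw [inv_le_comm₀ (by linarith) (by norm_num)]; norm_num; linarith
    linarith
  have hdL : (1-d) * Real.log (1/(1-d^2)) ≤ 1/5 := by
    refine le_trans ?_ l3
    exact mul_le_mul_of_nonneg_right (by nlinarith) l1.le
  unfold Delta
  generalize Real.log (1/(1-d^2)) = L at *
  generalize Real.log (1+d) = g at *
  generalize I1 1 d = P at *
  generalize I2 1 d = Q at *
  have hP : 0 < P := by linarith
  have hQ : Q ≤ Real.pi / 2 * P := by
    have h1 : L / 2 ≤ d * P := by
      have : d * (g + L/2) ≤ d * P := mul_le_mul_of_nonneg_left A1 hd0.le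
      nlinarith
    have h2 : d * Q ≤ d * (Real.pi / 2 * P) := by nlinarith
    exact le_of_mul_le_mul_left h2 hd0
  have e : -Q / P / Real.pi + 1/2 = (Real.pi / 2 * P - Q) / (Real.pi * P) := by
    field_simp; ring
  rw [e]
  constructor
  · apply div_nonneg (by linarith) (by positivity)
  · rw [div_le_div_iff₀ (by positivity) l1]
    have h1 : Real.pi / 2 * P - Q ≤ Real.pi * (3/2) := by nlinarith
    have h2 : L ≤ 2 * P := by linarith
    calc _ ≤ (Real.pi * (3/2)) * L := mul_le_mul_of_nonneg_right h1 l1.le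
      _ ≤ (Real.pi * (3/2)) * (2 * P) := mul_le_mul_of_nonneg_left h2 (by positivity)
      _ = _ := by ring

lemma eta_bounds (d v : ℝ) (hd0 : 0 < d) (hd1 : d < 1) (hmod : mu2 1 d + d^2/2 = 5/6 - v/3) :
    1 - d^2 ≤ 2 * v / 5 := by
  have := mu2_le d hd0 hd1
  linarith

set_option maxHeartbeats 1000000 in
lemma Bg_core (d v : ℝ) (hd0 : 0 < d) (hd1 : d < 1) (hv : 0 < v) (hv1 : v ≤ 1/100)
    (hl : 100 ≤ Real.log (1/v)) (hmod : mu2 1 d + d^2/2 = 5/6 - v/3) :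
    |Bg 1 d / Real.pi - 8 * v / Real.log (1/v)| ≤
      632 * (v * Real.log (Real.log (1/v)) / (Real.log (1/v))^2) := by
  have hη0 : 0 < 1 - d^2 := by nlinarith
  have hη1 := eta_bounds d v hd0 hd1 hmod
  have hη : 1 - d^2 ≤ 1/100 := by linarith
  have hd99 : 99/100 ≤ d := by nlinarith
  have hpi := Real.pi_pos
  obtain ⟨l1, l2, l3, l4⟩ := eta_log (1-d^2) hη0 hη
  obtain ⟨-, -, w3, -⟩ := eta_log v hv hv1
  have hm := mu2_asymp d hd0 hd1 hη
  have hB := Bg_asymp d hd99 hd1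
  have hmm : mu2 1 d - 1/3 = (1-d^2)/2 - v/3 := by linarith
  rw [hmm] at hm hB
  have hratio : Real.log (1/(1-d^2)) - Real.log (1/v) = Real.log (v / (1-d^2)) := by
    rw [← Real.log_div (by positivity) (by positivity)]
    congr 1
    field_simp
  have hLl : 0 ≤ Real.log (v / (1-d^2)) := by
    apply Real.log_nonneg
    rw [le_div_iff₀ hη0]; linarith
  generalize 1 - d^2 = η at *
  generalize Bg 1 d = B at *
  set L := Real.log (1/η) with hLdef
  set l := Real.log (1/v) with hldef
  rw [abs_le] at hm
  have k1 : η * L ≤ 2 * v + 33 * η := by linarith [hm.1, hm.2]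
  have k2 : 2 * v ≤ η * L + 33 * η := by linarith [hm.1, hm.2]
  have hL : l ≤ L := by linarith
  have hηl : η * l ≤ 4 * v := by
    have : η * l ≤ η * L := mul_le_mul_of_nonneg_left hL hη0.le
    nlinarith
  have hvη : v / η ≤ L := by
    rw [div_le_iff₀ hη0]; nlinarith
  have hLpos : 0 < L := by linarith
  have k3 : L - l ≤ Real.log L := by
    rw [hratio]
    exact Real.log_le_log (by positivity) hvη
  have k4 : Real.log L ≤ L / 2 := by
    have h := Real.log_le_sub_one_of_pos (show 0 < L / 2 by linarith)
    rw [Real.log_div hLpos.ne' (by norm_num)] at h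
    have := Real.log_two_lt_d9
    linarith
  have k5 : L ≤ 2 * l := by linarith
  have hlogl : 1 ≤ Real.log l := by
    rw [Real.le_log_iff_exp_le (by linarith)]
    have := Real.exp_one_lt_d9
    linarith
  have k6 : Real.log L ≤ 2 * Real.log l := by
    have h := Real.log_le_log hLpos k5
    rw [Real.log_mul (by norm_num) (by linarith)] at h
    have := Real.log_two_lt_d9
    linarith
  generalize Real.log l = g at *
  have k7 : |η * l - 2 * v| ≤ 35 * η * g := by
    have hg : η * 1 ≤ η * g := mul_le_mul_of_nonneg_left hlogl hη0.le
    have h1 : η * (L - l) ≤ η * (2 * g) := mul_le_mul_of_nonneg_left (by linarith) hη0.le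
    have h2 : 0 ≤ η * (L - l) := mul_nonneg hη0.le (by linarith)
    rw [abs_le]
    constructor <;> linarith
  have hlpos : 0 < l := by linarith
  have s1 : |4 * η - 8 * v / l| ≤ 560 * (v * g / l^2) := by
    have : 4 * η - 8 * v / l = 4 * (η * l - 2 * v) / l := by field_simp; ring
    rw [this, abs_div, abs_mul, abs_of_pos hlpos, abs_of_pos (show (0:ℝ) < 4 by norm_num)]
    rw [show 560 * (v * g / l^2) = (560 * (v * g) / l) / l by field_simp]
    apply div_le_div_of_nonneg_right _ hlpos.le
    rw [le_div_iff₀ hlpos]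
    have : η * l * g ≤ 4 * v * g := mul_le_mul_of_nonneg_right hηl (by linarith)
    have h3 := mul_le_mul_of_nonneg_right k7 hlpos.le
    linarith
  have s2 : |B / Real.pi - 4 * η| ≤ 72 * (v * g / l^2) := by
    have : B / Real.pi - 4 * η = (B - 4 * Real.pi * η) / Real.pi := by field_simp
    rw [this, abs_div, abs_of_pos hpi, div_le_iff₀ hpi]
    refine hB.trans ?_
    have ha : |η/2 - v/3| ≤ η/2 + v/3 := by
      rw [abs_le]; constructor <;> linarith
    have h1 : 3 * η + 2 * |η/2 - v/3| ≤ 3 * v := by linarith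
    have h2 : η * v ≤ 4 * (v * g / l^2) := by
      rw [← mul_div_assoc, le_div_iff₀ (by positivity)]
      calc η * v * l^2 = (η * l) * (v * l) := by ring
        _ ≤ (4 * v) * g := mul_le_mul hηl (by linarith) (by positivity) (by linarith)
        _ = _ := by ring
    calc 6 * Real.pi * η * (3 * η + 2 * |η/2 - v/3|) ≤ 6 * Real.pi * η * (3 * v) :=
          mul_le_mul_of_nonneg_left h1 (by positivity)
      _ = 18 * Real.pi * (η * v) := by ring
      _ ≤ 18 * Real.pi * (4 * (v * g / l^2)) := mul_le_mul_of_nonneg_left h2 (by positivity)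
      _ = _ := by ring
  calc |B / Real.pi - 8 * v / l| = |(B / Real.pi - 4 * η) + (4 * η - 8 * v / l)| := by ring_nf
    _ ≤ _ := abs_add_le _ _
    _ ≤ _ := by linarith

lemma reduce (c : ℝ) (hc : 0 < c) (f : ℝ → ℝ)
    (hmap : ∀ ξ ∈ Set.Icc (-c^2/2) (c^2/3), f ξ ∈ Set.Icc 0 c)
    (hmono : StrictMonoOn f (Set.Icc (-c^2/2) (c^2/3)))
    (hmod : ∀ ξ ∈ Set.Icc (-c^2/2) (c^2/3),
      c^2/2 + ξ = mu2 c (f ξ) + (f ξ)^2/2) (v : ℝ) (hv : 0 < v) (hv1 : v ≤ 1) :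
    ∃ d, 0 < d ∧ d < 1 ∧ mu2 1 d + d^2/2 = 5/6 - v/3 ∧
      ∀ t, zvar c f t (c^2 * (1 - v) / 3) = (t * c^3) * (Bg 1 d / Real.pi) + Delta 1 d / Real.pi := by
  have hc2 : 0 < c^2 := by positivity
  have hcv : 0 < c^2 * v := by positivity
  have hcv1 : c^2 * v ≤ c^2 * 1 := mul_le_mul_of_nonneg_left hv1 hc2.le
  have m0 : -c^2/2 ∈ Set.Icc (-c^2/2) (c^2/3) := ⟨le_refl _, by linarith⟩
  have m2 : c^2/3 ∈ Set.Icc (-c^2/2) (c^2/3) := ⟨by linarith, le_refl _⟩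
  have m1 : c^2 * (1 - v) / 3 ∈ Set.Icc (-c^2/2) (c^2/3) := ⟨by nlinarith, by nlinarith⟩
  have h0 := hmono m0 m1 (by nlinarith)
  have h1 := hmono m1 m2 (by nlinarith)
  have h2 := (hmap _ m0).1
  have h3 := (hmap _ m2).2
  have hm := hmod _ m1
  obtain ⟨d, hd⟩ : ∃ d, f (c^2 * (1 - v) / 3) = c * d := ⟨f (c^2 * (1 - v) / 3) / c, by field_simp⟩
  rw [hd] at h0 h1 hm
  refine ⟨d, ?_, ?_, ?_, ?_⟩
  · exact pos_of_mul_pos_right (h2.trans_lt h0) hc.le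
  · have : c * d < c * 1 := by linarith
    exact lt_of_mul_lt_mul_left this hc.le
  · rw [mu2_scale c d hc] at hm
    apply mul_left_cancel₀ hc2.ne'
    linarith
  · intro t
    unfold zvar
    rw [hd, Bg_scale c d hc, Delta_scale c d hc]
    ring

theorem stmt13 (c : ℝ) (hc : 0 < c) (f : ℝ → ℝ)
    (hmap : ∀ ξ ∈ Set.Icc (-c^2/2) (c^2/3), f ξ ∈ Set.Icc 0 c)
    (hcont : ContinuousOn f (Set.Icc (-c^2/2) (c^2/3)))
    (hmono : StrictMonoOn f (Set.Icc (-c^2/2) (c^2/3)))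
    (hmod : ∀ ξ ∈ Set.Icc (-c^2/2) (c^2/3),
      c^2/2 + ξ = mu2 c (f ξ) + (f ξ)^2/2) :
    (∃ C > 0, ∃ v₀ > 0, ∀ t : ℝ, 0 < t → ∀ v : ℝ, 0 < v → v < v₀ →
      |zvar c f t (c^2 * (1 - v) / 3) - 8 * c^3 * t * v / Real.log (1/v) + 1/2|
        ≤ C * (1 / Real.log (1/v) +
            t * v * Real.log (Real.log (1/v)) / (Real.log (1/v))^2)) ∧
    (∃ v₁ > 0, ∀ t : ℝ, 0 < t → ∀ v : ℝ, 0 < v → v < v₁ →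
      -1/2 ≤ zvar c f t (c^2 * (1 - v) / 3)) := by
  have hexp : Real.exp (-100) ≤ 1/100 := by
    rw [Real.exp_neg, inv_le_comm₀ (Real.exp_pos _) (by norm_num)]
    have := Real.add_one_le_exp (100:ℝ)
    linarith
  have hlog : ∀ v : ℝ, 0 < v → v < Real.exp (-100) → 100 ≤ Real.log (1/v) := by
    intro v hv hv1
    have := Real.log_lt_log hv hv1
    rw [Real.log_exp] at this
    rw [one_div, Real.log_inv]
    linarith
  constructor
  · refine ⟨3 + 632 * c^3, by positivity, Real.exp (-100), Real.exp_pos _, ?_⟩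
    intro t ht v hv hv1
    obtain ⟨d, hd0, hd1, hm, hz⟩ := reduce c hc f hmap hmono hmod v hv (by linarith)
    have hl := hlog v hv hv1
    have hη1 := eta_bounds d v hd0 hd1 hm
    have hη0 : 0 < 1 - d^2 := by nlinarith
    have hB := Bg_core d v hd0 hd1 hv (by linarith) hl hm
    obtain ⟨D0, D1⟩ := Delta_core d hd0 hd1 (by linarith)
    have hLl : Real.log (1/v) ≤ Real.log (1/(1-d^2)) := by
      apply Real.log_le_log (by positivity)
      apply one_div_le_one_div_of_le hη0
      linarith
    rw [hz]
    have D2 : Delta 1 d / Real.pi + 1/2 ≤ 3 / Real.log (1/v) :=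
      D1.trans (div_le_div_of_nonneg_left (by norm_num) (by linarith) hLl)
    have hg : 0 ≤ Real.log (Real.log (1/v)) := Real.log_nonneg (by linarith)
    generalize Real.log (Real.log (1/v)) = g at *
    generalize Real.log (1/v) = l at *
    have hl0 : 0 < l := by linarith
    have X0 : 0 ≤ 1 / l := by positivity
    have Y0 : 0 ≤ t * v * g / l^2 := by positivity
    have e : t * c^3 * (Bg 1 d / Real.pi) + Delta 1 d / Real.pi - 8 * c^3 * t * v / l + 1/2
        = t * c^3 * (Bg 1 d / Real.pi - 8 * v / l) + (Delta 1 d / Real.pi + 1/2) := by ring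
    rw [e]
    have hc3 : 0 < c^3 := by positivity
    calc _ ≤ |t * c^3 * (Bg 1 d / Real.pi - 8 * v / l)| + |Delta 1 d / Real.pi + 1/2| := abs_add_le _ _
      _ = t * c^3 * |Bg 1 d / Real.pi - 8 * v / l| + (Delta 1 d / Real.pi + 1/2) := by
        rw [abs_mul, abs_of_pos (show 0 < t * c^3 by positivity), abs_of_nonneg D0]
      _ ≤ t * c^3 * (632 * (v * g / l^2)) + 3 / l := by gcongr
      _ = 632 * c^3 * (t * v * g / l^2) + 3 * (1 / l) := by ring
      _ ≤ _ := by
        have : 0 ≤ c^3 * (1/l) := by positivity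
        nlinarith
  · refine ⟨Real.exp (-100), Real.exp_pos _, ?_⟩
    intro t ht v hv hv1
    obtain ⟨d, hd0, hd1, hm, hz⟩ := reduce c hc f hmap hmono hmod v hv (by linarith)
    have hη1 := eta_bounds d v hd0 hd1 hm
    obtain ⟨D0, D1⟩ := Delta_core d hd0 hd1 (by linarith)
    have hB := Bg_nonneg d hd0 hd1
    rw [hz]
    have hpi := Real.pi_pos
    have : 0 ≤ t * c^3 * (Bg 1 d / Real.pi) := by positivity
    linarith
end
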